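/- The edge Folkman number F(3,5;13) is at most 24: there exists a graph G with |V(G)| = 24 and clique number cl(G) = 12 < 13 such that G → (3,5), namely G = K₄ + C₅ + C₅ + C₅ + C₅, the join of a 4-clique with four disjoint 5-cycles. -/

import Mathlib

open SimpleGraph

/-- A blue-red coloring of the edges of `G`: a partition `E(G) = E₁ ∪ E₂`,
`E₁ ∩ E₂ = ∅` (edges in `E₁` are blue, edges in `E₂` are red). -/
def IsBRColoring {V : Type*} (G : SimpleGraph V) (E1 E2 : Set (Sym2 V)) : Prop :=
  E1 ∪ E2 = G.edgeSet ∧ E1 ∩ E2 = ∅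

/-- `G` has an `n`-clique all of whose edges lie in the edge set `E`
(a monochromatic `n`-clique in the color `E`). -/
def HasMonoNClique {V : Type*} (G : SimpleGraph V) (E : Set (Sym2 V)) (n : ℕ) : Prop :=
  ∃ S : Finset V, G.IsNClique n S ∧ ∀ x ∈ S, ∀ y ∈ S, x ≠ y → s(x, y) ∈ E

/-- The blue-red coloring `E1, E2` is `(p,q)`-free: there is no blue `p`-clique
and no red `q`-clique. -/
def IsPQFree {V : Type*} (G : SimpleGraph V) (E1 E2 : Set (Sym2 V)) (p q : ℕ) : Prop :=
  ¬ HasMonoNClique G E1 p ∧ ¬ HasMonoNClique G E2 q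

/-- `G → (p,q)` : no blue-red coloring of `E(G)` is `(p,q)`-free. -/
def Arrows {V : Type*} (G : SimpleGraph V) (p q : ℕ) : Prop :=
  ∀ E1 E2 : Set (Sym2 V), IsBRColoring G E1 E2 → ¬ IsPQFree G E1 E2 p q

/-- The neighborhood of `v` in the color `E`: all neighbors `u` of `v`
with `[v,u] ∈ E`.  With `E = E1` this is `N₁(v)`, with `E = E2` it is `N₂(v)`. -/
def colorNbhd {V : Type*} (G : SimpleGraph V) (E : Set (Sym2 V)) (v : V) : Set V :=
  {u | G.Adj v u ∧ s(v, u) ∈ E}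

/-- The join `G + H` of two graphs on disjoint vertex sets: all edges of `G`,
all edges of `H`, and all pairs `[x,y]` with `x ∈ V(G)`, `y ∈ V(H)`. -/
def graphJoin {α β : Type*} (G : SimpleGraph α) (H : SimpleGraph β) :
    SimpleGraph (α ⊕ β) where
  Adj x y :=
    match x, y with
    | .inl a, .inl b => G.Adj a b
    | .inr a, .inr b => H.Adj a b
    | .inl _, .inr _ => True
    | .inr _, .inl _ => True
  symm := ⟨by rintro (a | a) (b | b) <;> simp [SimpleGraph.adj_comm]⟩
  loopless := ⟨by rintro (a | a) <;> simp⟩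

/-- `G` contains a copy of `H` as a subgraph: there is an injective map of the
vertices of `H` into the vertices of `G` sending edges to edges. -/
def ContainsCopy {V W : Type*} (G : SimpleGraph V) (H : SimpleGraph W) : Prop :=
  ∃ f : W ↪ V, ∀ a b : W, H.Adj a b → G.Adj (f a) (f b)

/-- `s` is an independent set of `G`: no two of its vertices are adjacent. -/
def IsIndepSet {V : Type*} (G : SimpleGraph V) (s : Set V) : Prop :=
  ∀ x ∈ s, ∀ y ∈ s, ¬ G.Adj x y

/-- The vertex set of `K₄ + C₅ + C₅ + C₅ + C₅`. -/
abbrev V24 : Type := Fin 4 ⊕ (Fin 5 ⊕ (Fin 5 ⊕ (Fin 5 ⊕ Fin 5)))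

/-- The graph `K₄ + C₅⁽¹⁾ + C₅⁽²⁾ + C₅⁽³⁾ + C₅⁽⁴⁾`. -/
def G24 : SimpleGraph V24 :=
  graphJoin (⊤ : SimpleGraph (Fin 4))
    (graphJoin (cycleGraph 5)
      (graphJoin (cycleGraph 5) (graphJoin (cycleGraph 5) (cycleGraph 5))))

/-- The edge Folkman number `F(p,q;r) = min{|V(G)| : G → (p,q) and cl(G) < r}`. -/
noncomputable def folkmanNumber (p q r : ℕ) : ℕ :=
  sInf {n : ℕ | ∃ G : SimpleGraph (Fin n), Arrows G p q ∧ G.cliqueNum < r}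


namespace Folk

/-! ### Boolean facts about the 5-cycle -/

lemma all5 (P : (Fin 5 → Prop) → Prop)
    (h : ∀ p : Fin 5 → Bool, P (fun j => p j = true)) (p : Fin 5 → Prop) : P p := by
  classical
  have := h (fun j => decide (p j))
  simpa using this

lemma odd_cycle (p : Fin 5 → Prop) : ∃ i, (p i ↔ p (i + 1)) := by
  revert p
  apply all5
  decide

lemma indep_gap (p : Fin 5 → Prop) (h : ∀ j, ¬ (p j ∧ p (j + 1))) :
    ∃ j, ¬ p j ∧ ¬ p (j + 1) := by
  revert p
  apply all5
  decide

lemma indep_two (p q : Fin 5 → Prop) (hp : ∀ j, ¬ (p j ∧ p (j + 1)))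
    (hq : ∀ j, ¬ (q j ∧ q (j + 1))) : ∃ j, ¬ p j ∧ ¬ q j := by
  revert p
  apply all5
  intro p
  revert q
  apply all5
  revert p
  decide

lemma types (p : Fin 5 → Prop) :
    (∀ j, p j) ∨ ((∃ j, ¬ p j) ∧ (∃ j, p j ∧ p (j + 1)) ∧ ∀ j, ¬ p j → p (j + 1)) ∨
    ((∃ j, ¬ p j ∧ ¬ p (j + 1)) ∧ ∃ j, p j) ∨ (∀ j, ¬ p j) := by
  revert p
  apply all5
  decide

/-! ### Colourings -/

variable {V : Type*} {G : SimpleGraph V} {r : V → V → Prop} {P Q : V → Prop}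

/-- `r` is the set of red edges, there are no blue triangles. -/
structure Col (G : SimpleGraph V) (r : V → V → Prop) : Prop where
  symm : ∀ x y, r x y → r y x
  blue : ∀ x y z, G.Adj x y → G.Adj x z → G.Adj y z → r x y ∨ r x z ∨ r y z

/-- no red clique with `n` vertices in `P`. -/
def NR (G : SimpleGraph V) (r : V → V → Prop) (P : V → Prop) (n : ℕ) : Prop :=
  ∀ s : Finset V, s.card = n → (∀ x ∈ s, ∀ y ∈ s, x ≠ y → G.Adj x y ∧ r x y) →
    (∀ x ∈ s, P x) → False

/-- there is a clique of size `n` in `X` with vertices satisfying `P`. -/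
def HK (G : SimpleGraph V) (P : V → Prop) (X : Set V) (n : ℕ) : Prop :=
  ∃ s : Finset V, s.card = n ∧ (∀ x ∈ s, ∀ y ∈ s, x ≠ y → G.Adj x y) ∧
    (∀ x ∈ s, P x ∧ x ∈ X)

def Jn (G : SimpleGraph V) (X Y : Set V) : Prop := ∀ x ∈ X, ∀ y ∈ Y, G.Adj x y

lemma Jn.union_left {X Y Z : Set V} (h1 : Jn G X Z) (h2 : Jn G Y Z) : Jn G (X ∪ Y) Z := by
  rintro x (hx | hx) y hy
  · exact h1 x hx y hy
  · exact h2 x hx y hy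

lemma HK.zero (G : SimpleGraph V) (P : V → Prop) (X : Set V) : HK G P X 0 :=
  ⟨∅, by simp⟩

lemma HK.one {X : Set V} {x : V} (h : P x) (hx : x ∈ X) : HK G P X 1 :=
  ⟨{x}, by simp, by simp, by simp [h, hx]⟩

lemma HK.two {X : Set V} {x y : V} (h : P x) (hx : x ∈ X) (h' : P y) (hy : y ∈ X)
    (ha : G.Adj x y) : HK G P X 2 := by
  classical
  refine ⟨{x, y}, by simp [ha.ne], ?_, by simp [*]⟩
  simp only [Finset.mem_insert, Finset.mem_singleton]
  rintro a (rfl | rfl) b (rfl | rfl) h <;> first | exact absurd rfl h | exact ha | exact ha.symm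

lemma HK.join {X Y : Set V} {m n : ℕ} (h1 : HK G P X m) (h2 : HK G P Y n) (h : Jn G X Y) :
    HK G P (X ∪ Y) (m + n) := by
  classical
  obtain ⟨s, hs, hs1, hs2⟩ := h1
  obtain ⟨t, ht, ht1, ht2⟩ := h2
  refine ⟨s ∪ t, ?_, ?_, ?_⟩
  · rw [Finset.card_union_of_disjoint, hs, ht]
    rw [Finset.disjoint_left]
    intro x hx hx'
    exact (h x (hs2 x hx).2 x (ht2 x hx').2).ne rfl
  · intro x hx y hy hxy
    rcases Finset.mem_union.1 hx with hx | hx <;> rcases Finset.mem_union.1 hy with hy | hy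
    · exact hs1 x hx y hy hxy
    · exact h x (hs2 x hx).2 y (ht2 y hy).2
    · exact (h y (hs2 y hy).2 x (ht2 x hx).2).symm
    · exact ht1 x hx y hy hxy
  · intro x hx
    rcases Finset.mem_union.1 hx with hx | hx
    · exact ⟨(hs2 x hx).1, Or.inl (hs2 x hx).2⟩
    · exact ⟨(ht2 x hx).1, Or.inr (ht2 x hx).2⟩

lemma HK.mono {X Y : Set V} {m n : ℕ} (h : HK G P X m) (hn : n ≤ m)
    (hP : ∀ x, P x → x ∈ X → Q x ∧ x ∈ Y) : HK G Q Y n := by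
  obtain ⟨s, hs, hs1, hs2⟩ := h
  obtain ⟨t, ht, ht'⟩ := Finset.exists_subset_card_eq (hn.trans hs.ge)
  exact ⟨t, ht', fun x hx y hy => hs1 x (ht hx) y (ht hy),
    fun x hx => hP x (hs2 x (ht hx)).1 (hs2 x (ht hx)).2⟩

/-- A clique blue to `v` is red. -/
lemma blue_side (hc : Col G r) {v : V} {X : Set V} {n q : ℕ} (hR : NR G r P q)
    (hX : ∀ x ∈ X, P x ∧ G.Adj v x) (h : HK G (fun x => ¬ r v x) X n) : n < q := by
  by_contra hn
  obtain ⟨s, hs, hs1, hs2⟩ :=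
    h.mono (not_lt.1 hn) (Q := fun x => ¬ r v x) (Y := X) (fun x h h' => ⟨h, h'⟩)
  refine hR s hs ?_ (fun x hx => (hX x (hs2 x hx).2).1)
  intro x hx y hy hxy
  refine ⟨hs1 x hx y hy hxy, ?_⟩
  rcases hc.blue v x y (hX x (hs2 x hx).2).2 (hX y (hs2 y hy).2).2 (hs1 x hx y hy hxy) with h | h | h
  · exact absurd h (hs2 x hx).1
  · exact absurd h (hs2 y hy).1
  · exact h

/-- The red neighbourhood. -/
lemma red_side (hc : Col G r) {v : V} {q : ℕ} (hR : NR G r P (q + 1)) (hv : P v) :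
    NR G r (fun x => P x ∧ G.Adj v x ∧ r v x) q := by
  classical
  intro s hs hs1 hs2
  have hvs : v ∉ s := fun h => (hs2 v h).2.1.ne rfl
  refine hR (insert v s) (by rw [Finset.card_insert_of_notMem hvs, hs]) ?_ ?_
  · intro x hx y hy hxy
    rcases Finset.mem_insert.1 hx with hx' | hx' <;> rcases Finset.mem_insert.1 hy with hy' | hy'
    · exact absurd (hx'.trans hy'.symm) hxy
    · subst hx'
      exact (hs2 y hy').2
    · subst hy'
      exact ⟨(hs2 x hx').2.1.symm, hc.symm _ _ (hs2 x hx').2.2⟩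
    · exact hs1 x hx' y hy' hxy
  · intro x hx
    rcases Finset.mem_insert.1 hx with rfl | hx
    · exact hv
    · exact (hs2 x hx).1

lemma NR.two (hR : NR G r P 2) (hc : Col G r) {x y : V} (hx : P x) (hy : P y)
    (ha : G.Adj x y) : ¬ r x y := by
  classical
  intro h
  refine hR {x, y} (by simp [ha.ne]) ?_ (by simp [*])
  simp only [Finset.mem_insert, Finset.mem_singleton]
  have := hc.symm _ _ h
  have := ha.symm
  rintro a (rfl | rfl) b (rfl | rfl) h <;> simp_all

lemma NR.three (hR : NR G r P 3) (hc : Col G r) {x y z : V} (hx : P x) (hy : P y) (hz : P z)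
    (h1 : G.Adj x y) (h2 : G.Adj x z) (h3 : G.Adj y z) : ¬ (r x y ∧ r x z ∧ r y z) :=
  fun ⟨a, b, c⟩ => (red_side hc hR hx).two hc ⟨hy, h1, a⟩ ⟨hz, h2, b⟩ h3 c

lemma NR.four (hR : NR G r P 4) (hc : Col G r) {x y z w : V} (hx : P x) (hy : P y) (hz : P z)
    (hw : P w) (h1 : G.Adj x y) (h2 : G.Adj x z) (h3 : G.Adj x w) (h4 : G.Adj y z)
    (h5 : G.Adj y w) (h6 : G.Adj z w) :
    ¬ (r x y ∧ r x z ∧ r x w ∧ r y z ∧ r y w ∧ r z w) :=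
  fun ⟨a, b, c, d, e, f⟩ =>
    (red_side hc hR hx).three hc ⟨hy, h1, a⟩ ⟨hz, h2, b⟩ ⟨hw, h3, c⟩ h4 h5 h6 ⟨d, e, f⟩

lemma NR.five (hR : NR G r P 5) (hc : Col G r) {u x y z w : V} (hu : P u) (hx : P x) (hy : P y)
    (hz : P z) (hw : P w) (g1 : G.Adj u x) (g2 : G.Adj u y) (g3 : G.Adj u z) (g4 : G.Adj u w)
    (h1 : G.Adj x y) (h2 : G.Adj x z) (h3 : G.Adj x w) (h4 : G.Adj y z)
    (h5 : G.Adj y w) (h6 : G.Adj z w) (i1 : r u x) (i2 : r u y) (i3 : r u z) (i4 : r u w) :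
    ¬ (r x y ∧ r x z ∧ r x w ∧ r y z ∧ r y w ∧ r z w) :=
  (red_side hc hR hu).four hc ⟨hx, g1, i1⟩ ⟨hy, g2, i2⟩ ⟨hz, g3, i3⟩ ⟨hw, g4, i4⟩ h1 h2 h3 h4 h5 h6

/-- A finite clique split by the colours at `v`. -/
lemma split_clique (r : V → V → Prop) (v : V) (s : Finset V)
    (hs : ∀ x ∈ s, ∀ y ∈ s, x ≠ y → G.Adj x y) :
    ∃ w ρ, w + ρ = s.card ∧ HK G (fun x => ¬ r v x) (s : Set V) w ∧
      HK G (fun x => r v x) (s : Set V) ρ ∧ (w = 0 → ∀ x ∈ s, r v x) ∧ (ρ = 0 → ∀ x ∈ s, ¬ r v x) ∧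
      (w = 1 → ∀ x ∈ s, ∀ y ∈ s, x ≠ y → ¬ r v x → r v y) := by
  classical
  refine ⟨(s.filter (fun x => ¬ r v x)).card, (s.filter (fun x => r v x)).card, ?_,
    ⟨_, rfl, ?_, ?_⟩, ⟨_, rfl, ?_, ?_⟩, ?_, ?_, ?_⟩
  · rw [add_comm]; exact Finset.card_filter_add_card_filter_not _
  · intro x hx y hy
    exact hs x (Finset.mem_filter.1 hx).1 y (Finset.mem_filter.1 hy).1
  · intro x hx
    exact ⟨(Finset.mem_filter.1 hx).2, (Finset.mem_filter.1 hx).1⟩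
  · intro x hx y hy
    exact hs x (Finset.mem_filter.1 hx).1 y (Finset.mem_filter.1 hy).1
  · intro x hx
    exact ⟨(Finset.mem_filter.1 hx).2, (Finset.mem_filter.1 hx).1⟩
  · intro h x hx
    by_contra h'
    have : x ∈ s.filter (fun x => ¬ r v x) := Finset.mem_filter.2 ⟨hx, h'⟩
    rw [Finset.card_eq_zero.1 h] at this
    simp at this
  · intro h x hx h'
    have : x ∈ s.filter (fun x => r v x) := Finset.mem_filter.2 ⟨hx, h'⟩
    rw [Finset.card_eq_zero.1 h] at this
    simp at this
  · intro h x hx y hy hxy h1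
    by_contra h2
    exact hxy (Finset.card_le_one.1 h.le x (Finset.mem_filter.2 ⟨hx, h1⟩) y
      (Finset.mem_filter.2 ⟨hy, h2⟩))

lemma split_cycle (r : V → V → Prop) (v : V) (A : Fin 5 → V) (hA : ∀ i, G.Adj (A i) (A (i + 1))) :
    ∃ w ρ, HK G (fun x => ¬ r v x) (Set.range A) w ∧ HK G (fun x => r v x) (Set.range A) ρ ∧
      ((w = 0 ∧ ρ = 2 ∧ ∀ j, r v (A j)) ∨
       (w = 1 ∧ ρ = 2 ∧ (∃ j, ¬ r v (A j)) ∧ ∀ j, ¬ r v (A j) → r v (A (j + 1))) ∨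
       (w = 2 ∧ ρ = 1) ∨ (w = 2 ∧ ρ = 0 ∧ ∀ j, ¬ r v (A j))) := by
  have m : ∀ j, A j ∈ Set.range A := fun j => ⟨j, rfl⟩
  rcases types (fun j => r v (A j)) with h | ⟨⟨i, h1⟩, ⟨j, h2⟩, h3⟩ | ⟨⟨i, h1⟩, ⟨j, h2⟩⟩ | h
  · exact ⟨0, 2, HK.zero _ _ _, HK.two (h 0) (m _) (h 1) (m _) (hA 0), Or.inl ⟨rfl, rfl, h⟩⟩
  · exact ⟨1, 2, HK.one h1 (m _), HK.two h2.1 (m _) h2.2 (m _) (hA j),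
      Or.inr (Or.inl ⟨rfl, rfl, ⟨i, h1⟩, h3⟩)⟩
  · exact ⟨2, 1, HK.two h1.1 (m _) h1.2 (m _) (hA i), HK.one h2 (m _),
      Or.inr (Or.inr (Or.inl ⟨rfl, rfl⟩))⟩
  · exact ⟨2, 0, HK.two (h 0) (m _) (h 1) (m _) (hA 0), HK.zero _ _ _,
      Or.inr (Or.inr (Or.inr ⟨rfl, rfl, h⟩))⟩

/-! ### Complete graphs -/

lemma K6 (hc : Col G r) (hR : NR G r P 3) {X : Set V} (h : HK G P X 6) : False := by
  classical
  obtain ⟨s, hs, hs1, hs2⟩ := h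
  obtain ⟨v, hv⟩ : s.Nonempty := Finset.card_pos.1 (by omega)
  obtain ⟨w, ρ, h1, h2, h3, -⟩ := split_clique (G := G) r v (s.erase v)
    (fun x hx y hy => hs1 x (Finset.mem_of_mem_erase hx) y (Finset.mem_of_mem_erase hy))
  have hX : ∀ x ∈ ((s.erase v : Finset V) : Set V), P x ∧ G.Adj v x := by
    intro x hx
    have := Finset.mem_erase.1 hx
    exact ⟨(hs2 x this.2).1, hs1 v hv x this.2 this.1.symm⟩
  have h4 := blue_side hc hR hX h2
  rw [Finset.card_erase_of_mem hv, hs] at h1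
  obtain ⟨t, ht, ht1, ht2⟩ := h3.mono (n := 3) (by omega)
    (Q := fun x => P x ∧ G.Adj v x ∧ r v x) (Y := Set.univ)
    (fun x h h' => ⟨⟨(hX x h').1, (hX x h').2, h⟩, trivial⟩)
  obtain ⟨x, y, z, hxy, hxz, hyz, rfl⟩ := Finset.card_eq_three.1 ht
  have hR2 := red_side hc hR (hs2 v hv).1
  have ax := ht1 x (by simp) y (by simp) hxy
  have ay := ht1 x (by simp) z (by simp) hxz
  have az := ht1 y (by simp) z (by simp) hyz
  have b1 := ht2 x (by simp)
  have b2 := ht2 y (by simp)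
  have b3 := ht2 z (by simp)
  rcases hc.blue x y z ax ay az with h | h | h
  · exact hR2.two hc b1.1 b2.1 ax h
  · exact hR2.two hc b1.1 b3.1 ay h
  · exact hR2.two hc b2.1 b3.1 az h

lemma K9 (hc : Col G r) (hR : NR G r P 4) {X : Set V} (h : HK G P X 9) : False := by
  classical
  obtain ⟨s, hs, hs1, hs2⟩ := h
  let B : SimpleGraph s :=
    { Adj := fun x y => x ≠ y ∧ ¬ r x y
      symm := ⟨fun x y h => ⟨h.1.symm, fun h' => h.2 (hc.symm _ _ h')⟩⟩
      loopless := ⟨fun x h => h.1 rfl⟩ }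
  have hdeg : ∀ x : s, B.degree x = 3 := by
    rintro ⟨v, hv⟩
    have e : B.degree ⟨v, hv⟩ = ((s.erase v).filter (fun x => ¬ r v x)).card := by
      rw [← SimpleGraph.card_neighborFinset_eq_degree]
      rw [← Finset.card_map (Function.Embedding.subtype _)]
      congr 1
      ext x
      simp only [Finset.mem_map, SimpleGraph.mem_neighborFinset, Finset.mem_filter, Finset.mem_erase,
        Function.Embedding.coe_subtype, Subtype.exists, exists_and_right, exists_eq_right, B]
      constructor
      · rintro ⟨⟨h, h1⟩, h2⟩
        exact ⟨⟨fun h' => h1 (Subtype.ext h'.symm), h⟩, h2⟩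
      · rintro ⟨⟨h1, h2⟩, h3⟩
        exact ⟨⟨h2, fun h' => h1 (congrArg Subtype.val h').symm⟩, h3⟩
    have hX : ∀ x ∈ ((s.erase v : Finset V) : Set V), P x ∧ G.Adj v x := by
      intro x hx
      have := Finset.mem_erase.1 hx
      exact ⟨(hs2 x this.2).1, hs1 v hv x this.2 this.1.symm⟩
    have h1 := blue_side hc hR hX (n := ((s.erase v).filter (fun x => ¬ r v x)).card)
      ⟨_, rfl, fun x hx y hy => hs1 x (Finset.mem_of_mem_erase (Finset.mem_filter.1 hx).1) y
        (Finset.mem_of_mem_erase (Finset.mem_filter.1 hy).1), fun x hx =>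
          ⟨(Finset.mem_filter.1 hx).2, (Finset.mem_filter.1 hx).1⟩⟩
    have h2 := Finset.card_filter_add_card_filter_not (s := s.erase v) (fun x => r v x)
    rw [Finset.card_erase_of_mem hv, hs] at h2
    have h3 : ((s.erase v).filter (fun x => r v x)).card < 6 := by
      by_contra hcon
      have : HK G (fun x => P x ∧ G.Adj v x ∧ r v x) Set.univ
          ((s.erase v).filter (fun x => r v x)).card :=
        ⟨_, rfl, fun x hx y hy => hs1 x (Finset.mem_of_mem_erase (Finset.mem_filter.1 hx).1) y
          (Finset.mem_of_mem_erase (Finset.mem_filter.1 hy).1), fun x hx =>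
          ⟨⟨(hX x (Finset.mem_filter.1 hx).1).1, (hX x (Finset.mem_filter.1 hx).1).2,
            (Finset.mem_filter.1 hx).2⟩, trivial⟩⟩
      exact K6 hc (red_side hc hR (hs2 v hv).1)
        (this.mono (n := 6) (not_lt.1 hcon) (fun x h h' => ⟨h, h'⟩))
    omega
  have hsum := B.sum_degrees_eq_twice_card_edges
  simp only [hdeg, Finset.sum_const, Finset.card_univ, Fintype.card_coe, hs, smul_eq_mul] at hsum
  omega

/-- `K₃ + C₅ → (3,3)`. -/
lemma K3C5 (hc : Col G r) (hR : NR G r P 3) {A : Fin 5 → V} (hA : ∀ i, G.Adj (A i) (A (i + 1)))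
    (hAP : ∀ i, P (A i)) {X : Set V} (h : HK G P X 3) (hX : Jn G X (Set.range A)) : False := by
  classical
  obtain ⟨s, hs, hs1, hs2⟩ := h
  obtain ⟨x, y, z, hxy, hxz, hyz, rfl⟩ := Finset.card_eq_three.1 hs
  have axy := hs1 x (by simp) y (by simp) hxy
  have axz := hs1 x (by simp) z (by simp) hxz
  have ayz := hs1 y (by simp) z (by simp) hyz
  have b1 := hs2 x (by simp)
  have b2 := hs2 y (by simp)
  have b3 := hs2 z (by simp)
  have key : ∀ v k l : V, P v → P k → P l → v ∈ X → k ∈ X → l ∈ X → G.Adj v k → G.Adj v l →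
      r v k → r v l := by
    intro v k l pv pk pl mv mk ml avk avl h1
    by_contra h2
    have jv : ∀ j, G.Adj v (A j) := fun j => hX v mv _ ⟨j, rfl⟩
    have jk : ∀ j, G.Adj k (A j) := fun j => hX k mk _ ⟨j, rfl⟩
    have jl : ∀ j, G.Adj l (A j) := fun j => hX l ml _ ⟨j, rfl⟩
    obtain ⟨i, hi⟩ := odd_cycle (fun j => r v (A j))
    by_cases h : r v (A i)
    · have h' := hi.1 h
      have e1 := hR.three hc pv pk (hAP i) avk (jv i) (jk i)
      have e2 := hR.three hc pv pk (hAP (i + 1)) avk (jv _) (jk _)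
      have e3 := hR.three hc pv (hAP i) (hAP (i + 1)) (jv _) (jv _) (hA i)
      have e4 := hc.blue k (A i) (A (i + 1)) (jk _) (jk _) (hA i)
      tauto
    · have h' := mt hi.2 h
      have e1 := hc.blue v l (A i) avl (jv _) (jl _)
      have e2 := hc.blue v l (A (i + 1)) avl (jv _) (jl _)
      have e3 := hc.blue v (A i) (A (i + 1)) (jv _) (jv _) (hA i)
      have e4 := hR.three hc pl (hAP i) (hAP (i + 1)) (jl _) (jl _) (hA i)
      tauto
  have e1 := key x y z b1.1 b2.1 b3.1 b1.2 b2.2 b3.2 axy axz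
  have e2 := key x z y b1.1 b3.1 b2.1 b1.2 b3.2 b2.2 axz axy
  have e3 := key y x z b2.1 b1.1 b3.1 b2.2 b1.2 b3.2 axy.symm ayz
  have e4 := key y z x b2.1 b3.1 b1.1 b2.2 b3.2 b1.2 ayz axy.symm
  have e5 := hc.blue x y z axy axz ayz
  have e6 := hR.three hc b1.1 b2.1 b3.1 axy axz ayz
  have s1 := hc.symm x y
  have s2 := hc.symm y x
  tauto

lemma jn_range {A B : Fin 5 → V} (h : ∀ i j, G.Adj (A i) (B j)) :
    Jn G (Set.range A) (Set.range B) := by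
  rintro _ ⟨i, rfl⟩ _ ⟨j, rfl⟩
  exact h i j

/-- Colours at a vertex of the `K₄` in `K₄ + C₅ + C₅`. -/
lemma side44 (hc : Col G r) (hR : NR G r P 4) {A B : Fin 5 → V}
    (hA : ∀ i, G.Adj (A i) (A (i + 1))) (hB : ∀ i, G.Adj (B i) (B (i + 1)))
    (hAB : ∀ i j, G.Adj (A i) (B j)) (hAP : ∀ i, P (A i)) (hBP : ∀ i, P (B i))
    {v : V} {s : Finset V} (hs : s.card = 3) (hs1 : ∀ x ∈ s, ∀ y ∈ s, x ≠ y → G.Adj x y)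
    (hsP : ∀ x ∈ s, P x) (hvP : P v) (hv : ∀ x ∈ s, G.Adj v x)
    (sA : ∀ x ∈ s, ∀ j, G.Adj x (A j)) (sB : ∀ x ∈ s, ∀ j, G.Adj x (B j))
    (vA : ∀ j, G.Adj v (A j)) (vB : ∀ j, G.Adj v (B j)) :
    ((∀ x ∈ s, ¬ r v x) ∧ (∀ j, r v (A j)) ∧ (∀ j, r v (B j))) ∨
    ((∀ x ∈ s, ∀ y ∈ s, x ≠ y → ¬ r v x → r v y) ∧
      (((∀ j, ¬ r v (A j)) ∧ (∀ j, ¬ r v (B j) → r v (B (j + 1))) ∧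
          ((∃ x ∈ s, ¬ r v x) → ∀ j, r v (B j))) ∨
       ((∀ j, ¬ r v (B j)) ∧ (∀ j, ¬ r v (A j) → r v (A (j + 1))) ∧
          ((∃ x ∈ s, ¬ r v x) → ∀ j, r v (A j))))) := by
  obtain ⟨w, ρ, h1, h2, h3, h4, h5, h6⟩ := split_clique (G := G) r v s hs1
  obtain ⟨wA, ρA, a1, a2, a3⟩ := split_cycle (G := G) r v A hA
  obtain ⟨wB, ρB, b1, b2, b3⟩ := split_cycle (G := G) r v B hB
  have jA : Jn G (s : Set V) (Set.range A) := by
    rintro x hx _ ⟨j, rfl⟩; exact sA x hx j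
  have jB : Jn G (s : Set V) (Set.range B) := by
    rintro x hx _ ⟨j, rfl⟩; exact sB x hx j
  have jAB := jn_range hAB
  have jBA : Jn G (Set.range B) (Set.range A) := jn_range (fun i j => (hAB j i).symm)
  have mem : ∀ x ∈ (s : Set V) ∪ Set.range A ∪ Set.range B, P x ∧ G.Adj v x := by
    rintro x ((hx | ⟨j, rfl⟩) | ⟨j, rfl⟩)
    · exact ⟨hsP x hx, hv x hx⟩
    · exact ⟨hAP j, vA j⟩
    · exact ⟨hBP j, vB j⟩
  have n1 := blue_side hc hR mem ((h2.join a1 jA).join b1 (jB.union_left jAB))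
  have hR' := red_side hc hR hvP
  have n2 : w = w ∧ ρ + ρA + ρB < 6 := by
    refine ⟨rfl, ?_⟩
    by_contra hcon
    exact K6 hc hR' (((h3.join a2 jA).join b2 (jB.union_left jAB)).mono (n := 6) (not_lt.1 hcon)
      (Y := Set.univ) (fun x hx hx' => ⟨⟨(mem x hx').1, (mem x hx').2, hx⟩, trivial⟩))
  have n3 : (∀ j, r v (A j)) → ρ + ρB < 3 := by
    intro hall
    by_contra hcon
    refine K3C5 hc hR' hA (fun i => ⟨hAP i, vA i, hall i⟩) ((h3.join b2 jB).mono (n := 3)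
      (not_lt.1 hcon) (fun x hx hx' => ⟨?_, hx'⟩)) (jA.union_left jBA)
    have : x ∈ (s : Set V) ∪ Set.range A ∪ Set.range B := by
      rcases hx' with h | h
      · exact Or.inl (Or.inl h)
      · exact Or.inr h
    exact ⟨(mem x this).1, (mem x this).2, hx⟩
  have n4 : (∀ j, r v (B j)) → ρ + ρA < 3 := by
    intro hall
    by_contra hcon
    refine K3C5 hc hR' hB (fun i => ⟨hBP i, vB i, hall i⟩) ((h3.join a2 jA).mono (n := 3)
      (not_lt.1 hcon) (fun x hx hx' => ⟨?_, hx'⟩)) (jB.union_left jAB)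
    have : x ∈ (s : Set V) ∪ Set.range A ∪ Set.range B := Or.inl hx'
    exact ⟨(mem x this).1, (mem x this).2, hx⟩
  have n2' := n2.2
  rw [hs] at h1
  rcases a3 with ⟨e1, e2, e3⟩ | ⟨e1, e2, e4, e3⟩ | ⟨e1, e2⟩ | ⟨e1, e2, e3⟩ <;>
  rcases b3 with ⟨f1, f2, f3⟩ | ⟨f1, f2, f4, f3⟩ | ⟨f1, f2⟩ | ⟨f1, f2, f3⟩
  · have := n3 e3
    exact Or.inl ⟨h5 (by omega), e3, f3⟩
  · have := n3 e3
    omega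
  · have := n3 e3
    omega
  · have := n3 e3
    exact Or.inr ⟨h6 (by omega), Or.inr ⟨f3, fun j _ => e3 _, fun _ => e3⟩⟩
  · have := n4 f3
    omega
  · omega
  · omega
  · have h0 := h4 (by omega)
    refine Or.inr ⟨fun x hx y hy _ _ => h0 y hy, Or.inr ⟨f3, e3, ?_⟩⟩
    rintro ⟨x, hx, hx'⟩
    exact absurd (h0 x hx) hx'
  · have := n4 f3
    omega
  · omega
  · omega
  · omega
  · have := n4 f3
    exact Or.inr ⟨h6 (by omega), Or.inl ⟨e3, fun j _ => f3 _, fun _ => f3⟩⟩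
  · have h0 := h4 (by omega)
    refine Or.inr ⟨fun x hx y hy _ _ => h0 y hy, Or.inl ⟨e3, f3, ?_⟩⟩
    rintro ⟨x, hx, hx'⟩
    exact absurd (h0 x hx) hx'
  · omega
  · omega

lemma cyc_red (hc : Col G r) {A : Fin 5 → V} (hA : ∀ i, G.Adj (A i) (A (i + 1))) {v : V}
    (vA : ∀ j, G.Adj v (A j)) (h : ∀ j, ¬ r v (A j)) (j : Fin 5) : r (A j) (A (j + 1)) := by
  have := hc.blue v (A j) (A (j + 1)) (vA _) (vA _) (hA j)
  have := h j
  have := h (j + 1)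
  tauto

/-- `K₄ + C₅ + C₅ → (3,4)`. -/
lemma K4C5C5 (hc : Col G r) (hR : NR G r P 4) {A B : Fin 5 → V}
    (hA : ∀ i, G.Adj (A i) (A (i + 1))) (hB : ∀ i, G.Adj (B i) (B (i + 1)))
    (hAB : ∀ i j, G.Adj (A i) (B j)) (hAP : ∀ i, P (A i)) (hBP : ∀ i, P (B i))
    {X : Set V} (h : HK G P X 4) (hXA : Jn G X (Set.range A)) (hXB : Jn G X (Set.range B)) :
    False := by
  classical
  obtain ⟨s, hs, hs1, hs2⟩ := h
  have sA : ∀ x ∈ s, ∀ j, G.Adj x (A j) := fun x hx j => hXA x (hs2 x hx).2 _ ⟨j, rfl⟩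
  have sB : ∀ x ∈ s, ∀ j, G.Adj x (B j) := fun x hx j => hXB x (hs2 x hx).2 _ ⟨j, rfl⟩
  have sP : ∀ x ∈ s, P x := fun x hx => (hs2 x hx).1
  have side : ∀ v ∈ s,
    ((∀ x ∈ s, x ≠ v → ¬ r v x) ∧ (∀ j, r v (A j)) ∧ (∀ j, r v (B j))) ∨
    ((∀ x ∈ s, ∀ y ∈ s, x ≠ v → y ≠ v → x ≠ y → ¬ r v x → r v y) ∧
      (((∀ j, ¬ r v (A j)) ∧ (∀ j, ¬ r v (B j) → r v (B (j + 1))) ∧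
          ((∃ x ∈ s, x ≠ v ∧ ¬ r v x) → ∀ j, r v (B j))) ∨
       ((∀ j, ¬ r v (B j)) ∧ (∀ j, ¬ r v (A j) → r v (A (j + 1))) ∧
          ((∃ x ∈ s, x ≠ v ∧ ¬ r v x) → ∀ j, r v (A j))))) := by
    intro v hv
    have := side44 hc hR hA hB hAB hAP hBP (v := v) (s := s.erase v)
      (by rw [Finset.card_erase_of_mem hv, hs])
      (fun x hx y hy => hs1 x (Finset.mem_of_mem_erase hx) y (Finset.mem_of_mem_erase hy))
      (fun x hx => sP x (Finset.mem_of_mem_erase hx)) (sP v hv)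
      (fun x hx => hs1 v hv x (Finset.mem_of_mem_erase hx) (Finset.ne_of_mem_erase hx).symm)
      (fun x hx => sA x (Finset.mem_of_mem_erase hx))
      (fun x hx => sB x (Finset.mem_of_mem_erase hx)) (sA v hv) (sB v hv)
    rcases this with ⟨h1, h2⟩ | ⟨h1, h2⟩
    · exact Or.inl ⟨fun x hx hxv => h1 x (Finset.mem_erase.2 ⟨hxv, hx⟩), h2⟩
    · refine Or.inr ⟨fun x hx y hy hxv hyv => h1 x (Finset.mem_erase.2 ⟨hxv, hx⟩) y
        (Finset.mem_erase.2 ⟨hyv, hy⟩), ?_⟩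
      rcases h2 with ⟨g1, g2, g3⟩ | ⟨g1, g2, g3⟩
      · exact Or.inl ⟨g1, g2, fun ⟨x, hx, hxv, hh⟩ => g3 ⟨x, Finset.mem_erase.2 ⟨hxv, hx⟩, hh⟩⟩
      · exact Or.inr ⟨g1, g2, fun ⟨x, hx, hxv, hh⟩ => g3 ⟨x, Finset.mem_erase.2 ⟨hxv, hx⟩, hh⟩⟩
  have rs := hc.symm
  -- no vertex is blue to all the others
  have nostar : ∀ v ∈ s, ¬ ∀ x ∈ s, x ≠ v → ¬ r v x := by
    intro v hv hstar
    have h3 : (s.erase v).card = 3 := by rw [Finset.card_erase_of_mem hv, hs]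
    obtain ⟨a, b, c, hab, hac, hbc, he⟩ := Finset.card_eq_three.1 h3
    have ha : a ∈ s.erase v := by rw [he]; simp
    have hb : b ∈ s.erase v := by rw [he]; simp
    have hd : c ∈ s.erase v := by rw [he]; simp
    obtain ⟨av, ha⟩ := Finset.mem_erase.1 ha
    obtain ⟨bv, hb⟩ := Finset.mem_erase.1 hb
    obtain ⟨cv, hd⟩ := Finset.mem_erase.1 hd
    have rr : ∀ x ∈ s, ∀ y ∈ s, x ≠ v → y ≠ v → x ≠ y → r x y := by
      intro x hx y hy hxv hyv hxy
      have := hc.blue v x y (hs1 v hv x hx hxv.symm) (hs1 v hv y hy hyv.symm) (hs1 x hx y hy hxy)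
      have := hstar x hx hxv
      have := hstar y hy hyv
      tauto
    have ty : ∀ x ∈ s, x ≠ v → ∀ y ∈ s, y ≠ v → x ≠ y →
        ((∀ j, ¬ r x (A j)) ∧ ∀ j, r x (B j)) ∨ ((∀ j, ¬ r x (B j)) ∧ ∀ j, r x (A j)) := by
      intro x hx hxv y hy hyv hxy
      have hb : ∃ y ∈ s, y ≠ x ∧ ¬ r x y := ⟨v, hv, hxv.symm, fun h => hstar x hx hxv (rs _ _ h)⟩
      rcases side x hx with ⟨h1, -⟩ | ⟨-, ⟨h1, -, h2⟩ | ⟨h1, -, h2⟩⟩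
      · exact absurd (rr x hx y hy hxv hyv hxy) (h1 y hy hxy.symm)
      · exact Or.inl ⟨h1, h2 hb⟩
      · exact Or.inr ⟨h1, h2 hb⟩
    -- two vertices of the same type
    have two : ∀ D : Fin 5 → V, (∀ i, G.Adj (D i) (D (i + 1))) → (∀ x ∈ s, ∀ j, G.Adj x (D j)) →
        (∀ i, P (D i)) → ∀ x ∈ s, ∀ y ∈ s, ∀ z ∈ s, x ≠ v → y ≠ v → z ≠ v → x ≠ y → x ≠ z →
        y ≠ z → (∀ j, r x (D j)) → (∀ j, r y (D j)) → ((∀ j, r z (D j)) ∨ ∀ j, ¬ r z (D j)) →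
        False := by
      intro D hD sD hDP x hx y hy z hz xv yv zv xy xz yz dx dy dz
      rcases dz with dz | dz
      · exact hR.four hc (sP x hx) (sP y hy) (sP z hz) (hDP 0) (hs1 x hx y hy xy)
          (hs1 x hx z hz xz) (sD x hx 0) (hs1 y hy z hz yz) (sD y hy 0) (sD z hz 0)
          ⟨rr x hx y hy xv yv xy, rr x hx z hz xv zv xz, dx 0, rr y hy z hz yv zv yz, dy 0, dz 0⟩
      · exact hR.four hc (sP x hx) (sP y hy) (hDP 0) (hDP 1) (hs1 x hx y hy xy)
          (sD x hx 0) (sD x hx 1) (sD y hy 0) (sD y hy 1) (hD 0)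
          ⟨rr x hx y hy xv yv xy, dx 0, dx 1, dy 0, dy 1, cyc_red hc hD (sD z hz) dz 0⟩
    rcases ty a ha av b hb bv hab with ⟨a1, a2⟩ | ⟨a1, a2⟩ <;>
    rcases ty b hb bv a ha av hab.symm with ⟨b1, b2⟩ | ⟨b1, b2⟩ <;>
    rcases ty c hd cv a ha av hac.symm with ⟨c1, c2⟩ | ⟨c1, c2⟩
    · exact two B hB sB hBP a ha b hb c hd av bv cv hab hac hbc a2 b2 (Or.inl c2)
    · exact two B hB sB hBP a ha b hb c hd av bv cv hab hac hbc a2 b2 (Or.inr c1)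
    · exact two B hB sB hBP a ha c hd b hb av cv bv hac hab hbc.symm a2 c2 (Or.inr b1)
    · exact two A hA sA hAP b hb c hd a ha bv cv av hbc hab.symm hac.symm b2 c2 (Or.inr a1)
    · exact two B hB sB hBP b hb c hd a ha bv cv av hbc hab.symm hac.symm b2 c2 (Or.inr a1)
    · exact two A hA sA hAP a ha c hd b hb av cv bv hac hab hbc.symm a2 c2 (Or.inr b1)
    · exact two A hA sA hAP a ha b hb c hd av bv cv hab hac hbc a2 b2 (Or.inr c1)
    · exact two A hA sA hAP a ha b hb c hd av bv cv hab hac hbc a2 b2 (Or.inl c2)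
  -- there is a blue edge
  obtain ⟨v, hv, w, hw, hvw, hbl⟩ : ∃ v ∈ s, ∃ w ∈ s, v ≠ w ∧ ¬ r v w := by
    by_contra hcon
    push Not at hcon
    exact hR s hs (fun x hx y hy hxy => ⟨hs1 x hx y hy hxy, hcon x hx y hy hxy⟩) sP
  have hbl' : ¬ r w v := fun h => hbl (rs _ _ h)
  obtain ⟨x, hx, hxvw⟩ : ∃ x ∈ s, x ∉ ({v, w} : Finset V) := by
    by_contra hcon
    push Not at hcon
    have := Finset.card_le_card (s := s) (t := {v, w}) hcon
    have := Finset.card_le_two (a := v) (b := w)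
    omega
  have hxv : x ≠ v := fun h => hxvw (by simp [h])
  have hxw : x ≠ w := fun h => hxvw (by simp [h])
  -- the final step
  have fin : ∀ D : Fin 5 → V, (∀ i, G.Adj (D i) (D (i + 1))) → (∀ x ∈ s, ∀ j, G.Adj x (D j)) →
      (∀ i, P (D i)) → ∀ y ∈ s, ∀ z ∈ s, y ≠ x → r y x → (∀ j, r y (D j)) → (∀ j, ¬ r z (D j)) →
      (∀ j, ¬ r x (D j) → r x (D (j + 1))) → False := by
    intro D hD sD hDP y hy z hz hyx ryx dy dz dx
    obtain ⟨j, h1, h2⟩ := indep_gap (fun j => ¬ r x (D j)) (fun j h => h.2 (dx j h.1))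
    exact hR.four hc (sP y hy) (sP x hx) (hDP j) (hDP (j + 1)) (hs1 y hy x hx hyx)
      (sD y hy _) (sD y hy _) (sD x hx _) (sD x hx _) (hD j)
      ⟨ryx, dy _, dy _, not_not.1 h1, not_not.1 h2, cyc_red hc hD (sD z hz) dz j⟩
  rcases side v hv with ⟨h1, -⟩ | ⟨v0, v1⟩
  · exact nostar v hv h1
  rcases side w hw with ⟨h1, -⟩ | ⟨w0, w1⟩
  · exact nostar w hw h1
  rcases side x hx with ⟨h1, -⟩ | ⟨-, x1⟩
  · exact nostar x hx h1
  have rvx := v0 w hw x hx hvw.symm hxv hxw.symm hbl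
  have rwx := w0 v hv x hx hvw hxw hxv.symm hbl'
  have ev : ∃ y ∈ s, y ≠ v ∧ ¬ r v y := ⟨w, hw, hvw.symm, hbl⟩
  have ew : ∃ y ∈ s, y ≠ w ∧ ¬ r w y := ⟨v, hv, hvw, hbl'⟩
  have tA := hc.blue v w (A 0) (hs1 v hv w hw hvw) (sA v hv 0) (sA w hw 0)
  have tB := hc.blue v w (B 0) (hs1 v hv w hw hvw) (sB v hv 0) (sB w hw 0)
  rcases v1 with ⟨v1, -, v2⟩ | ⟨v1, -, v2⟩ <;> rcases w1 with ⟨w1, -, w2⟩ | ⟨w1, -, w2⟩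
  · have := v1 0
    have := w1 0
    tauto
  · rcases x1 with ⟨x1, x2, -⟩ | ⟨x1, x2, -⟩
    · exact fin B hB sB hBP v hv w hw hxv.symm rvx (v2 ev) w1 x2
    · exact fin A hA sA hAP w hw v hv hxw.symm rwx (w2 ew) v1 x2
  · rcases x1 with ⟨x1, x2, -⟩ | ⟨x1, x2, -⟩
    · exact fin B hB sB hBP w hw v hv hxw.symm rwx (w2 ew) v1 x2
    · exact fin A hA sA hAP v hv w hw hxv.symm rvx (v2 ev) w1 x2
  · have := v1 0
    have := w1 0
    tauto

/-! ### Combinatorial core: red case -/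

structure RC (b c x : Fin 5 → Fin 5 → Prop) : Prop where
  i1 : ∀ a j k, b a j → c a k → x j k
  i2 : ∀ a j k, ¬ b a j → ¬ b (a + 1) j → ¬ c a k → ¬ c (a + 1) k → ¬ x j k
  ib : ∀ a j, b a j ∨ b (a + 1) j ∨ b a (j + 1) ∨ b (a + 1) (j + 1)
  ic : ∀ a j, c a j ∨ c (a + 1) j ∨ c a (j + 1) ∨ c (a + 1) (j + 1)
  x1 : ∀ j k, ¬ (x j k ∧ x (j + 1) k)
  x2 : ∀ j k, ¬ (x j k ∧ x j (k + 1))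

lemma RC.swap {b c x} (h : RC b c x) : RC c b (fun j k => x k j) where
  i1 a j k h1 h2 := h.i1 a k j h2 h1
  i2 a j k h1 h2 h3 h4 := h.i2 a k j h3 h4 h1 h2
  ib := h.ic
  ic := h.ib
  x1 j k := h.x2 k j
  x2 j k := h.x1 k j

lemma RC.emp {b c x} (h : RC b c x) (a : Fin 5) (hc : ∀ k, ¬ c a k) (j : Fin 5) :
    ¬ b (a + 1) j := by
  intro hb
  obtain ⟨k, h1, h2⟩ := indep_gap (fun k => ¬ c (a + 1) k) (fun k hk => by
    have := h.ic a k
    have := hc k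
    have := hc (k + 1)
    tauto)
  exact h.x2 j k ⟨h.i1 _ _ _ hb (not_not.1 h1), h.i1 _ _ _ hb (not_not.1 h2)⟩

lemma RC.ne {b c x} (h : RC b c x) (a : Fin 5) : ∃ k, c a k := by
  by_contra hcon
  push Not at hcon
  have h1 := h.emp a hcon
  have h2 := h.swap.emp _ h1
  have h3 := h.emp _ h2
  have h4 := h.swap.emp _ h3
  have h5 := h.ic (a + 1 + 1 + 1 + 1) 0
  have e : a + 1 + 1 + 1 + 1 + 1 = a :=
    (by decide : ∀ a : Fin 5, a + 1 + 1 + 1 + 1 + 1 = a) a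
  rw [e] at h5
  have := h4 0
  have := h4 1
  have := hcon 0
  have := hcon 1
  simp only [zero_add] at h5
  tauto

lemma RC.dis {b c x} (h : RC b c x) (a j : Fin 5) : ¬ (b a j ∧ b (a + 1) j) := by
  rintro ⟨h1, h2⟩
  obtain ⟨k, g1, g2⟩ := indep_two (fun k => x j k) (fun k => ¬ c a k ∧ ¬ c (a + 1) k)
    (fun k => h.x2 j k) (fun k hk => by have := h.ic a k; tauto)
  have := h.i1 a j k h1
  have := h.i1 (a + 1) j k h2
  tauto

lemma RC.ind {b c x} (h : RC b c x) (a j : Fin 5) : ¬ (b a j ∧ b a (j + 1)) := by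
  rintro ⟨h1, h2⟩
  obtain ⟨k, hk⟩ := h.ne a
  exact h.x1 j k ⟨h.i1 _ _ _ h1 hk, h.i1 _ _ _ h2 hk⟩

lemma RC.inter {b c x} (h : RC b c x) (a : Fin 5) : ∃ j, b a j ∧ b (a + 1 + 1) j := by
  by_contra hcon
  push Not at hcon
  obtain ⟨j, h1, h2⟩ := indep_gap (fun j => b (a + 1) j) (h.ind (a + 1))
  obtain ⟨w, hw⟩ := h.ne (a + 1 + 1)
  have e1 := h.ib a j
  have e2 := h.ib (a + 1) j
  have e3 := hcon j
  have e4 := hcon (j + 1)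
  have d := h.swap.dis (a + 1) w
  have i0 := h.ind a j
  have k1 := h.x1 j w
  have m1 := h.i1 a j w
  have m2 := h.i1 a (j + 1) w
  have m3 := h.i1 (a + 1 + 1) j w
  have m4 := h.i1 (a + 1 + 1) (j + 1) w
  have m5 := h.i2 a j w
  have m6 := h.i2 a (j + 1) w
  grind

lemma RC.uni {b c x} (h : RC b c x) (a j : Fin 5) :
    ¬ (b a j ∧ b (a + 1 + 1) (j + 1)) ∧ ¬ (b a (j + 1) ∧ b (a + 1 + 1) j) := by
  obtain ⟨k, h1, h2⟩ := h.swap.inter a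
  have k1 := h.x1 j k
  have m1 := h.i1 a j k
  have m2 := h.i1 a (j + 1) k
  have m3 := h.i1 (a + 1 + 1) j k
  have m4 := h.i1 (a + 1 + 1) (j + 1) k
  grind

lemma five (p : Fin 5) : p = 0 ∨ p = 1 ∨ p = 2 ∨ p = 3 ∨ p = 4 := by
  revert p; decide

lemma RC.false {b c x} (h : RC b c x) : False := by
  obtain ⟨p, p1, p2⟩ := h.inter 0
  obtain ⟨q, q1, q2⟩ := h.inter 3
  have u1 : ∀ j, ¬ (b 0 j ∧ b 2 (j + 1)) ∧ ¬ (b 0 (j + 1) ∧ b 2 j) := h.uni 0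
  have u2 : ∀ j, ¬ (b 3 j ∧ b 0 (j + 1)) ∧ ¬ (b 3 (j + 1) ∧ b 0 j) := h.uni 3
  have d : ∀ j, ¬ (b 2 j ∧ b 3 j) := h.dis 2
  have n : ∀ j, b 2 j ∨ b 3 j ∨ b 2 (j + 1) ∨ b 3 (j + 1) := h.ib 2
  have i0 := h.ind 0
  change b 2 p at p2
  change b 0 q at q2
  generalize b 0 = X at *
  generalize b 2 = Y at *
  generalize b 3 = Z at *
  clear h
  have u10 := u1 0
  have u11 := u1 1
  have u12 := u1 2
  have u13 := u1 3
  have u14 := u1 4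
  have u20 := u2 0
  have u21 := u2 1
  have u22 := u2 2
  have u23 := u2 3
  have u24 := u2 4
  have n0 := n 0
  have n1 := n 1
  have n2 := n 2
  have n3 := n 3
  have n4 := n 4
  have i00 := i0 0
  have i01 := i0 1
  have i02 := i0 2
  have i03 := i0 3
  have i04 := i0 4
  have dp := d p
  clear u1 u2 n i0
  simp only [show (0 : Fin 5) + 1 = 1 from rfl, show (1 : Fin 5) + 1 = 2 from rfl,
    show (2 : Fin 5) + 1 = 3 from rfl, show (3 : Fin 5) + 1 = 4 from rfl,
    show (4 : Fin 5) + 1 = 0 from rfl] at *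
  have dq := d q
  clear d
  have hp : p = 0 ∨ p = 1 ∨ p = 2 ∨ p = 3 ∨ p = 4 := five p
  have hq : q = 0 ∨ q = 1 ∨ q = 2 ∨ q = 3 ∨ q = 4 := five q
  rcases hp with rfl | rfl | rfl | rfl | rfl <;> rcases hq with rfl | rfl | rfl | rfl | rfl <;>
    grind

/-! ### Combinatorial core: blue case -/

structure BC (b c x : Fin 5 → Fin 5 → Prop) : Prop where
  i1 : ∀ a j k, b a j → c a k → x j k
  i2 : ∀ a j k, ¬ b a j → ¬ b (a + 1) j → ¬ c a k → ¬ c (a + 1) k → ¬ x j k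
  ib : ∀ a j, ¬ (b a j ∧ b a (j + 1))
  ic : ∀ a j, ¬ (c a j ∧ c a (j + 1))
  x1 : ∀ j k, x j k ∨ x (j + 1) k
  x2 : ∀ j k, x j k ∨ x j (k + 1)

lemma BC.swap {b c x} (h : BC b c x) : BC c b (fun j k => x k j) where
  i1 a j k h1 h2 := h.i1 a k j h2 h1
  i2 a j k h1 h2 h3 h4 := h.i2 a k j h3 h4 h1 h2
  ib := h.ic
  ic := h.ib
  x1 j k := h.x2 k j
  x2 j k := h.x1 k j

lemma BC.tne {b c x} (h : BC b c x) (a : Fin 5) : ∃ k, ¬ c a k ∧ ¬ c (a + 1) k :=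
  indep_two _ _ (h.ic a) (h.ic (a + 1))

lemma BC.tind {b c x} (h : BC b c x) (a j : Fin 5) :
    b a j ∨ b (a + 1) j ∨ b a (j + 1) ∨ b (a + 1) (j + 1) := by
  obtain ⟨k, h1, h2⟩ := h.tne a
  have := h.i2 a j k
  have := h.i2 a (j + 1) k
  have := h.x1 j k
  grind

lemma BC.inter {b c x} (h : BC b c x) (a : Fin 5) :
    ∃ j, ¬ b a j ∧ ¬ b (a + 1) j ∧ ¬ b (a + 1 + 1) j := by
  by_contra hcon
  push Not at hcon
  obtain ⟨j, h1, h2⟩ := indep_gap (fun j => b (a + 1) j) (h.ib (a + 1))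
  obtain ⟨w, hw, hw'⟩ := h.tne a
  have e3 := hcon j
  have e4 := hcon (j + 1)
  have i0 := h.ib a j
  have i2 := h.ib (a + 1 + 1) j
  have k1 := h.x1 j w
  have m3 := h.i1 (a + 1 + 1) j w
  have m4 := h.i1 (a + 1 + 1) (j + 1) w
  have m5 := h.i2 a j w
  have m6 := h.i2 a (j + 1) w
  have m7 := h.i2 (a + 1) j w
  have m8 := h.i2 (a + 1) (j + 1) w
  grind

lemma BC.uni {b c x} (h : BC b c x) (a j : Fin 5) :
    (b a j ∨ b (a + 1) j ∨ b (a + 1) (j + 1) ∨ b (a + 1 + 1) (j + 1)) ∧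
    (b a (j + 1) ∨ b (a + 1) (j + 1) ∨ b (a + 1) j ∨ b (a + 1 + 1) j) := by
  obtain ⟨k, h1, h2, h3⟩ := h.swap.inter a
  have k1 := h.x1 j k
  have m5 := h.i2 a j k
  have m6 := h.i2 a (j + 1) k
  have m7 := h.i2 (a + 1) j k
  have m8 := h.i2 (a + 1) (j + 1) k
  grind

lemma BC.false {b c x} (h : BC b c x) : False := by
  have ib := h.ib
  have t := h.tind
  have u := h.uni
  clear h
  have ib00 : ¬ (b 0 0 ∧ b 0 1) := ib 0 0
  have t00 : b 0 0 ∨ b 1 0 ∨ b 0 1 ∨ b 1 1 := t 0 0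
  have u00 : (b 0 0 ∨ b 1 0 ∨ b 1 1 ∨ b 2 1) ∧
    (b 0 1 ∨ b 1 1 ∨ b 1 0 ∨ b 2 0) := u 0 0
  have ib01 : ¬ (b 0 1 ∧ b 0 2) := ib 0 1
  have t01 : b 0 1 ∨ b 1 1 ∨ b 0 2 ∨ b 1 2 := t 0 1
  have u01 : (b 0 1 ∨ b 1 1 ∨ b 1 2 ∨ b 2 2) ∧
    (b 0 2 ∨ b 1 2 ∨ b 1 1 ∨ b 2 1) := u 0 1
  have ib02 : ¬ (b 0 2 ∧ b 0 3) := ib 0 2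
  have t02 : b 0 2 ∨ b 1 2 ∨ b 0 3 ∨ b 1 3 := t 0 2
  have u02 : (b 0 2 ∨ b 1 2 ∨ b 1 3 ∨ b 2 3) ∧
    (b 0 3 ∨ b 1 3 ∨ b 1 2 ∨ b 2 2) := u 0 2
  have ib03 : ¬ (b 0 3 ∧ b 0 4) := ib 0 3
  have t03 : b 0 3 ∨ b 1 3 ∨ b 0 4 ∨ b 1 4 := t 0 3
  have u03 : (b 0 3 ∨ b 1 3 ∨ b 1 4 ∨ b 2 4) ∧
    (b 0 4 ∨ b 1 4 ∨ b 1 3 ∨ b 2 3) := u 0 3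
  have ib04 : ¬ (b 0 4 ∧ b 0 0) := ib 0 4
  have t04 : b 0 4 ∨ b 1 4 ∨ b 0 0 ∨ b 1 0 := t 0 4
  have u04 : (b 0 4 ∨ b 1 4 ∨ b 1 0 ∨ b 2 0) ∧
    (b 0 0 ∨ b 1 0 ∨ b 1 4 ∨ b 2 4) := u 0 4
  have ib10 : ¬ (b 1 0 ∧ b 1 1) := ib 1 0
  have t10 : b 1 0 ∨ b 2 0 ∨ b 1 1 ∨ b 2 1 := t 1 0
  have u10 : (b 1 0 ∨ b 2 0 ∨ b 2 1 ∨ b 3 1) ∧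
    (b 1 1 ∨ b 2 1 ∨ b 2 0 ∨ b 3 0) := u 1 0
  have ib11 : ¬ (b 1 1 ∧ b 1 2) := ib 1 1
  have t11 : b 1 1 ∨ b 2 1 ∨ b 1 2 ∨ b 2 2 := t 1 1
  have u11 : (b 1 1 ∨ b 2 1 ∨ b 2 2 ∨ b 3 2) ∧
    (b 1 2 ∨ b 2 2 ∨ b 2 1 ∨ b 3 1) := u 1 1
  have ib12 : ¬ (b 1 2 ∧ b 1 3) := ib 1 2
  have t12 : b 1 2 ∨ b 2 2 ∨ b 1 3 ∨ b 2 3 := t 1 2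
  have u12 : (b 1 2 ∨ b 2 2 ∨ b 2 3 ∨ b 3 3) ∧
    (b 1 3 ∨ b 2 3 ∨ b 2 2 ∨ b 3 2) := u 1 2
  have ib13 : ¬ (b 1 3 ∧ b 1 4) := ib 1 3
  have t13 : b 1 3 ∨ b 2 3 ∨ b 1 4 ∨ b 2 4 := t 1 3
  have u13 : (b 1 3 ∨ b 2 3 ∨ b 2 4 ∨ b 3 4) ∧
    (b 1 4 ∨ b 2 4 ∨ b 2 3 ∨ b 3 3) := u 1 3
  have ib14 : ¬ (b 1 4 ∧ b 1 0) := ib 1 4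
  have t14 : b 1 4 ∨ b 2 4 ∨ b 1 0 ∨ b 2 0 := t 1 4
  have u14 : (b 1 4 ∨ b 2 4 ∨ b 2 0 ∨ b 3 0) ∧
    (b 1 0 ∨ b 2 0 ∨ b 2 4 ∨ b 3 4) := u 1 4
  have ib20 : ¬ (b 2 0 ∧ b 2 1) := ib 2 0
  have t20 : b 2 0 ∨ b 3 0 ∨ b 2 1 ∨ b 3 1 := t 2 0
  have u20 : (b 2 0 ∨ b 3 0 ∨ b 3 1 ∨ b 4 1) ∧
    (b 2 1 ∨ b 3 1 ∨ b 3 0 ∨ b 4 0) := u 2 0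
  have ib21 : ¬ (b 2 1 ∧ b 2 2) := ib 2 1
  have t21 : b 2 1 ∨ b 3 1 ∨ b 2 2 ∨ b 3 2 := t 2 1
  have u21 : (b 2 1 ∨ b 3 1 ∨ b 3 2 ∨ b 4 2) ∧
    (b 2 2 ∨ b 3 2 ∨ b 3 1 ∨ b 4 1) := u 2 1
  have ib22 : ¬ (b 2 2 ∧ b 2 3) := ib 2 2
  have t22 : b 2 2 ∨ b 3 2 ∨ b 2 3 ∨ b 3 3 := t 2 2
  have u22 : (b 2 2 ∨ b 3 2 ∨ b 3 3 ∨ b 4 3) ∧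
    (b 2 3 ∨ b 3 3 ∨ b 3 2 ∨ b 4 2) := u 2 2
  have ib23 : ¬ (b 2 3 ∧ b 2 4) := ib 2 3
  have t23 : b 2 3 ∨ b 3 3 ∨ b 2 4 ∨ b 3 4 := t 2 3
  have u23 : (b 2 3 ∨ b 3 3 ∨ b 3 4 ∨ b 4 4) ∧
    (b 2 4 ∨ b 3 4 ∨ b 3 3 ∨ b 4 3) := u 2 3
  have ib24 : ¬ (b 2 4 ∧ b 2 0) := ib 2 4
  have t24 : b 2 4 ∨ b 3 4 ∨ b 2 0 ∨ b 3 0 := t 2 4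
  have u24 : (b 2 4 ∨ b 3 4 ∨ b 3 0 ∨ b 4 0) ∧
    (b 2 0 ∨ b 3 0 ∨ b 3 4 ∨ b 4 4) := u 2 4
  have ib30 : ¬ (b 3 0 ∧ b 3 1) := ib 3 0
  have t30 : b 3 0 ∨ b 4 0 ∨ b 3 1 ∨ b 4 1 := t 3 0
  have u30 : (b 3 0 ∨ b 4 0 ∨ b 4 1 ∨ b 0 1) ∧
    (b 3 1 ∨ b 4 1 ∨ b 4 0 ∨ b 0 0) := u 3 0
  have ib31 : ¬ (b 3 1 ∧ b 3 2) := ib 3 1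
  have t31 : b 3 1 ∨ b 4 1 ∨ b 3 2 ∨ b 4 2 := t 3 1
  have u31 : (b 3 1 ∨ b 4 1 ∨ b 4 2 ∨ b 0 2) ∧
    (b 3 2 ∨ b 4 2 ∨ b 4 1 ∨ b 0 1) := u 3 1
  have ib32 : ¬ (b 3 2 ∧ b 3 3) := ib 3 2
  have t32 : b 3 2 ∨ b 4 2 ∨ b 3 3 ∨ b 4 3 := t 3 2
  have u32 : (b 3 2 ∨ b 4 2 ∨ b 4 3 ∨ b 0 3) ∧
    (b 3 3 ∨ b 4 3 ∨ b 4 2 ∨ b 0 2) := u 3 2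
  have ib33 : ¬ (b 3 3 ∧ b 3 4) := ib 3 3
  have t33 : b 3 3 ∨ b 4 3 ∨ b 3 4 ∨ b 4 4 := t 3 3
  have u33 : (b 3 3 ∨ b 4 3 ∨ b 4 4 ∨ b 0 4) ∧
    (b 3 4 ∨ b 4 4 ∨ b 4 3 ∨ b 0 3) := u 3 3
  have ib34 : ¬ (b 3 4 ∧ b 3 0) := ib 3 4
  have t34 : b 3 4 ∨ b 4 4 ∨ b 3 0 ∨ b 4 0 := t 3 4
  have u34 : (b 3 4 ∨ b 4 4 ∨ b 4 0 ∨ b 0 0) ∧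
    (b 3 0 ∨ b 4 0 ∨ b 4 4 ∨ b 0 4) := u 3 4
  have ib40 : ¬ (b 4 0 ∧ b 4 1) := ib 4 0
  have t40 : b 4 0 ∨ b 0 0 ∨ b 4 1 ∨ b 0 1 := t 4 0
  have u40 : (b 4 0 ∨ b 0 0 ∨ b 0 1 ∨ b 1 1) ∧
    (b 4 1 ∨ b 0 1 ∨ b 0 0 ∨ b 1 0) := u 4 0
  have ib41 : ¬ (b 4 1 ∧ b 4 2) := ib 4 1
  have t41 : b 4 1 ∨ b 0 1 ∨ b 4 2 ∨ b 0 2 := t 4 1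
  have u41 : (b 4 1 ∨ b 0 1 ∨ b 0 2 ∨ b 1 2) ∧
    (b 4 2 ∨ b 0 2 ∨ b 0 1 ∨ b 1 1) := u 4 1
  have ib42 : ¬ (b 4 2 ∧ b 4 3) := ib 4 2
  have t42 : b 4 2 ∨ b 0 2 ∨ b 4 3 ∨ b 0 3 := t 4 2
  have u42 : (b 4 2 ∨ b 0 2 ∨ b 0 3 ∨ b 1 3) ∧
    (b 4 3 ∨ b 0 3 ∨ b 0 2 ∨ b 1 2) := u 4 2
  have ib43 : ¬ (b 4 3 ∧ b 4 4) := ib 4 3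
  have t43 : b 4 3 ∨ b 0 3 ∨ b 4 4 ∨ b 0 4 := t 4 3
  have u43 : (b 4 3 ∨ b 0 3 ∨ b 0 4 ∨ b 1 4) ∧
    (b 4 4 ∨ b 0 4 ∨ b 0 3 ∨ b 1 3) := u 4 3
  have ib44 : ¬ (b 4 4 ∧ b 4 0) := ib 4 4
  have t44 : b 4 4 ∨ b 0 4 ∨ b 4 0 ∨ b 0 0 := t 4 4
  have u44 : (b 4 4 ∨ b 0 4 ∨ b 0 0 ∨ b 1 0) ∧
    (b 4 0 ∨ b 0 0 ∨ b 0 4 ∨ b 1 4) := u 4 4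
  clear ib t u
  generalize b 0 0 = b00 at *
  generalize b 0 1 = b01 at *
  generalize b 0 2 = b02 at *
  generalize b 0 3 = b03 at *
  generalize b 0 4 = b04 at *
  generalize b 1 0 = b10 at *
  generalize b 1 1 = b11 at *
  generalize b 1 2 = b12 at *
  generalize b 1 3 = b13 at *
  generalize b 1 4 = b14 at *
  generalize b 2 0 = b20 at *
  generalize b 2 1 = b21 at *
  generalize b 2 2 = b22 at *
  generalize b 2 3 = b23 at *
  generalize b 2 4 = b24 at *
  generalize b 3 0 = b30 at *
  generalize b 3 1 = b31 at *
  generalize b 3 2 = b32 at *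
  generalize b 3 3 = b33 at *
  generalize b 3 4 = b34 at *
  generalize b 4 0 = b40 at *
  generalize b 4 1 = b41 at *
  generalize b 4 2 = b42 at *
  generalize b 4 3 = b43 at *
  generalize b 4 4 = b44 at *
  grind (splits := 40)

/-! ### Monochromatic cycles -/

lemma mono1 (hc : Col G r) (hR : NR G r P 3) {B C : Fin 5 → V}
    (hB : ∀ i, G.Adj (B i) (B (i + 1))) (hC : ∀ i, G.Adj (C i) (C (i + 1)))
    (hBC : ∀ i j, G.Adj (B i) (C j)) (hBP : ∀ i, P (B i)) (hCP : ∀ i, P (C i)) (j : Fin 5) :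
    r (C j) (C (j + 1)) ↔ r (C (j + 1)) (C (j + 1 + 1)) := by
  obtain ⟨i, hi⟩ := odd_cycle (fun i => r (B i) (C (j + 1)))
  have key : ∀ b b' c d d' : V, P b → P b' → P c → P d → P d' → G.Adj b b' → G.Adj b c →
      G.Adj b d → G.Adj b d' → G.Adj b' c → G.Adj b' d → G.Adj b' d' → G.Adj c d → G.Adj c d' →
      (r b c ↔ r b' c) → r c d → r c d' := by
    intro b b' c d d' pb pb' pc pd pd' a1 a2 a3 a4 a5 a6 a7 a8 a9 h h1
    by_contra h2
    have e1 := hR.three hc pb pc pd a2 a3 a8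
    have e2 := hR.three hc pb' pc pd a5 a6 a8
    have e3 := hR.three hc pb pb' pc a1 a2 a5
    have e4 := hc.blue b b' d a1 a3 a6
    have e5 := hc.blue b c d' a2 a4 a9
    have e6 := hc.blue b' c d' a5 a7 a9
    have e7 := hR.three hc pb pb' pd' a1 a4 a7
    have e8 := hc.blue b b' c a1 a2 a5
    clear a1 a2 a3 a4 a5 a6 a7 a8 a9 pb pb' pc pd pd'
    by_cases hbc : r b c
    · have hbc' := h.1 hbc
      grind
    · have hbc' := mt h.2 hbc
      grind
  constructor
  · intro h
    exact key (B i) (B (i + 1)) (C (j + 1)) (C j) (C (j + 1 + 1)) (hBP _) (hBP _) (hCP _) (hCP _)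
      (hCP _) (hB i) (hBC _ _) (hBC _ _) (hBC _ _) (hBC _ _) (hBC _ _) (hBC _ _) (hC j).symm
      (hC (j + 1)) hi (hc.symm _ _ h)
  · intro h
    exact hc.symm _ _ (key (B i) (B (i + 1)) (C (j + 1)) (C (j + 1 + 1)) (C j) (hBP _) (hBP _)
      (hCP _) (hCP _) (hCP _) (hB i) (hBC _ _) (hBC _ _) (hBC _ _) (hBC _ _) (hBC _ _) (hBC _ _)
      (hC (j + 1)) (hC j).symm hi h)

lemma const5 (e : Fin 5 → Prop) (h : ∀ j, e j ↔ e (j + 1)) : (∀ j, e j) ∨ ∀ j, ¬ e j := by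
  revert e
  apply all5
  decide

lemma mono2 (hc : Col G r) (hR : NR G r P 3) {B C : Fin 5 → V}
    (hB : ∀ i, G.Adj (B i) (B (i + 1))) (hC : ∀ i, G.Adj (C i) (C (i + 1)))
    (hBC : ∀ i j, G.Adj (B i) (C j)) (hBP : ∀ i, P (B i)) (hCP : ∀ i, P (C i))
    (h : ∀ j, r (B j) (B (j + 1))) (k : Fin 5) : r (C k) (C (k + 1)) := by
  obtain ⟨j, h1, h2⟩ := indep_two (fun j => r (B j) (C k)) (fun j => r (B j) (C (k + 1)))
    (fun j hj => hR.three hc (hBP j) (hBP (j + 1)) (hCP k) (hB j) (hBC _ _) (hBC _ _)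
      ⟨h j, hj.1, hj.2⟩)
    (fun j hj => hR.three hc (hBP j) (hBP (j + 1)) (hCP (k + 1)) (hB j) (hBC _ _) (hBC _ _)
      ⟨h j, hj.1, hj.2⟩)
  have := hc.blue (B j) (C k) (C (k + 1)) (hBC _ _) (hBC _ _) (hC k)
  tauto

lemma mono (hc : Col G r) (hR : NR G r P 3) {B C : Fin 5 → V}
    (hB : ∀ i, G.Adj (B i) (B (i + 1))) (hC : ∀ i, G.Adj (C i) (C (i + 1)))
    (hBC : ∀ i j, G.Adj (B i) (C j)) (hBP : ∀ i, P (B i)) (hCP : ∀ i, P (C i)) :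
    ((∀ j, r (B j) (B (j + 1))) ∧ ∀ j, r (C j) (C (j + 1))) ∨
    ((∀ j, ¬ r (B j) (B (j + 1))) ∧ ∀ j, ¬ r (C j) (C (j + 1))) := by
  have hCB : ∀ i j, G.Adj (C i) (B j) := fun i j => (hBC j i).symm
  rcases const5 _ (mono1 hc hR hB hC hBC hBP hCP) with h1 | h1 <;>
  rcases const5 _ (mono1 hc hR hC hB hCB hCP hBP) with h2 | h2
  · exact Or.inl ⟨h2, h1⟩
  · exact absurd (mono2 hc hR hC hB hCB hCP hBP h1 0) (h2 0)
  · exact absurd (mono2 hc hR hB hC hBC hBP hCP h2 0) (h1 0)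
  · exact Or.inr ⟨h2, h1⟩

/-- blue to one cycle, red to the other two. -/
lemma core1 (hc : Col G r) (hR : NR G r P 4) {A B C : Fin 5 → V}
    (hA : ∀ i, G.Adj (A i) (A (i + 1)))
    (hB : ∀ i, G.Adj (B i) (B (i + 1))) (hC : ∀ i, G.Adj (C i) (C (i + 1)))
    (hAB : ∀ i j, G.Adj (A i) (B j)) (hAC : ∀ i j, G.Adj (A i) (C j))
    (hBC : ∀ i j, G.Adj (B i) (C j)) (hAP : ∀ i, P (A i)) (hBP : ∀ i, P (B i))
    (hCP : ∀ i, P (C i)) {v : V} (hv : P v) (vA : ∀ j, G.Adj v (A j)) (vB : ∀ j, G.Adj v (B j))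
    (vC : ∀ j, G.Adj v (C j)) (ba : ∀ j, ¬ r v (A j)) (rb : ∀ j, r v (B j))
    (rc : ∀ j, r v (C j)) : False := by
  have hA' := cyc_red hc hA vA ba
  have hR' := red_side hc hR hv
  have pB : ∀ j, P (B j) ∧ G.Adj v (B j) ∧ r v (B j) := fun j => ⟨hBP j, vB j, rb j⟩
  have pC : ∀ j, P (C j) ∧ G.Adj v (C j) ∧ r v (C j) := fun j => ⟨hCP j, vC j, rc j⟩
  have i1 : ∀ a j k, ¬ r (A a) (B j) → ¬ r (A a) (C k) → r (B j) (C k) := by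
    intro a j k h1 h2
    have := hc.blue (A a) (B j) (C k) (hAB _ _) (hAC _ _) (hBC _ _)
    tauto
  have i2 : ∀ a j k, ¬ ¬ r (A a) (B j) → ¬ ¬ r (A (a + 1)) (B j) → ¬ ¬ r (A a) (C k) →
      ¬ ¬ r (A (a + 1)) (C k) → ¬ r (B j) (C k) := by
    intro a j k h1 h2 h3 h4 h5
    exact hR.four hc (hAP a) (hAP (a + 1)) (hBP j) (hCP k) (hA a) (hAB _ _) (hAC _ _) (hAB _ _)
      (hAC _ _) (hBC _ _)
      ⟨hA' a, not_not.1 h1, not_not.1 h3, not_not.1 h2, not_not.1 h4, h5⟩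
  rcases mono hc hR' hB hC hBC pB pC with ⟨e1, e2⟩ | ⟨e1, e2⟩
  · refine RC.false (b := fun a j => ¬ r (A a) (B j)) (c := fun a k => ¬ r (A a) (C k))
      (x := fun j k => r (B j) (C k)) ⟨i1, i2, ?_, ?_, ?_, ?_⟩
    · intro a j
      have := hR.four hc (hAP a) (hAP (a + 1)) (hBP j) (hBP (j + 1)) (hA a) (hAB _ _) (hAB _ _)
        (hAB _ _) (hAB _ _) (hB j)
      have := hA' a
      have := e1 j
      tauto
    · intro a j
      have := hR.four hc (hAP a) (hAP (a + 1)) (hCP j) (hCP (j + 1)) (hA a) (hAC _ _) (hAC _ _)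
        (hAC _ _) (hAC _ _) (hC j)
      have := hA' a
      have := e2 j
      tauto
    · intro j k h
      exact hR'.three hc (pB j) (pB (j + 1)) (pC k) (hB j) (hBC _ _) (hBC _ _) ⟨e1 j, h.1, h.2⟩
    · intro j k h
      exact hR'.three hc (pB j) (pC k) (pC (k + 1)) (hBC _ _) (hBC _ _) (hC k) ⟨h.1, h.2, e2 k⟩
  · refine BC.false (b := fun a j => ¬ r (A a) (B j)) (c := fun a k => ¬ r (A a) (C k))
      (x := fun j k => r (B j) (C k)) ⟨i1, i2, ?_, ?_, ?_, ?_⟩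
    · intro a j
      have := hc.blue (A a) (B j) (B (j + 1)) (hAB _ _) (hAB _ _) (hB j)
      have := e1 j
      tauto
    · intro a j
      have := hc.blue (A a) (C j) (C (j + 1)) (hAC _ _) (hAC _ _) (hC j)
      have := e2 j
      tauto
    · intro j k
      have := hc.blue (B j) (B (j + 1)) (C k) (hB j) (hBC _ _) (hBC _ _)
      have := e1 j
      tauto
    · intro j k
      have := hc.blue (B j) (C k) (C (k + 1)) (hBC _ _) (hBC _ _) (hC k)
      have := e2 k
      tauto

lemma bool2 (p e σ τ : Fin 5 → Prop) (ps st : Prop)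
    (h1 : ∀ j, (p j ↔ p (j + 1)) → e j) (h2 : ∀ j, (ps ↔ p j) → σ j)
    (h3 : ∀ j, ¬ (σ j ∧ σ (j + 1) ∧ e j)) (h3' : ∀ j, ¬ (τ j ∧ τ (j + 1) ∧ e j))
    (h4 : ∀ j, ¬ (st ∧ σ j ∧ τ j)) (h5 : ∀ j, p j → σ j ∨ τ j)
    (h6 : ∀ j, p j → σ j ∨ e j) (h6' : ∀ j, p j → τ j ∨ e j)
    (h7 : ∀ j, p (j + 1) → σ (j + 1) ∨ e j) (h7' : ∀ j, p (j + 1) → τ (j + 1) ∨ e j)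
    (h8 : ∀ j, ps → st ∨ σ j) (h9 : ∀ j, ps → σ j ∨ σ (j + 1))
    (ha : ∀ j, σ j ∨ σ (j + 1) ∨ e j) (hb : ∀ j, τ j ∨ τ (j + 1) ∨ e j)
    (hd : ∀ j, st ∨ σ j ∨ τ j) : False := by
  have h1i := And.intro (h1 0) (And.intro (h1 1) (And.intro (h1 2) (And.intro (h1 3) (h1 4))))
  have h2i := And.intro (h2 0) (And.intro (h2 1) (And.intro (h2 2) (And.intro (h2 3) (h2 4))))
  have h3i := And.intro (h3 0) (And.intro (h3 1) (And.intro (h3 2) (And.intro (h3 3) (h3 4))))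
  have h3'i := And.intro (h3' 0) (And.intro (h3' 1) (And.intro (h3' 2) (And.intro (h3' 3) (h3' 4))))
  have h4i := And.intro (h4 0) (And.intro (h4 1) (And.intro (h4 2) (And.intro (h4 3) (h4 4))))
  have h5i := And.intro (h5 0) (And.intro (h5 1) (And.intro (h5 2) (And.intro (h5 3) (h5 4))))
  have h6i := And.intro (h6 0) (And.intro (h6 1) (And.intro (h6 2) (And.intro (h6 3) (h6 4))))
  have h6'i := And.intro (h6' 0) (And.intro (h6' 1) (And.intro (h6' 2) (And.intro (h6' 3) (h6' 4))))
  have h7i := And.intro (h7 0) (And.intro (h7 1) (And.intro (h7 2) (And.intro (h7 3) (h7 4))))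
  have h7'i := And.intro (h7' 0) (And.intro (h7' 1) (And.intro (h7' 2) (And.intro (h7' 3) (h7' 4))))
  have h8i := And.intro (h8 0) (And.intro (h8 1) (And.intro (h8 2) (And.intro (h8 3) (h8 4))))
  have h9i := And.intro (h9 0) (And.intro (h9 1) (And.intro (h9 2) (And.intro (h9 3) (h9 4))))
  have hai := And.intro (ha 0) (And.intro (ha 1) (And.intro (ha 2) (And.intro (ha 3) (ha 4))))
  have hbi := And.intro (hb 0) (And.intro (hb 1) (And.intro (hb 2) (And.intro (hb 3) (hb 4))))
  have hdi := And.intro (hd 0) (And.intro (hd 1) (And.intro (hd 2) (And.intro (hd 3) (hd 4))))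
  clear h1 h2 h3 h3' h4 h5 h6 h6' h7 h7' h8 h9 ha hb hd
  simp only [show (0 : Fin 5) + 1 = 1 from rfl, show (1 : Fin 5) + 1 = 2 from rfl,
    show (2 : Fin 5) + 1 = 3 from rfl, show (3 : Fin 5) + 1 = 4 from rfl,
    show (4 : Fin 5) + 1 = 0 from rfl] at *
  generalize p 0 = p0 at *
  generalize p 1 = p1 at *
  generalize p 2 = p2 at *
  generalize p 3 = p3 at *
  generalize p 4 = p4 at *
  generalize e 0 = e0 at *
  generalize e 1 = e1 at *
  generalize e 2 = e2 at *
  generalize e 3 = e3 at *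
  generalize e 4 = e4 at *
  generalize σ 0 = s0 at *
  generalize σ 1 = s1 at *
  generalize σ 2 = s2 at *
  generalize σ 3 = s3 at *
  generalize σ 4 = s4 at *
  generalize τ 0 = t0 at *
  generalize τ 1 = t1 at *
  generalize τ 2 = t2 at *
  generalize τ 3 = t3 at *
  generalize τ 4 = t4 at *
  by_cases ps <;> by_cases p0 <;> by_cases p1 <;> by_cases p2 <;> by_cases p3 <;> by_cases p4 <;>
    simp only [*, iff_true, true_iff, iff_false, false_iff, true_implies, false_implies,
      not_true, not_false_iff, iff_self, and_true, true_and, true_or, or_true] at * <;> grind (splits := 30)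

/-- blue to one cycle and to one vertex `i` of the second, red to the third. -/
lemma core2 (hc : Col G r) (hR : NR G r P 4) {A C : Fin 5 → V} {v i s t : V}
    (hA : ∀ i, G.Adj (A i) (A (i + 1))) (hC : ∀ i, G.Adj (C i) (C (i + 1)))
    (hAC : ∀ i j, G.Adj (A i) (C j)) (hAP : ∀ i, P (A i)) (hCP : ∀ i, P (C i))
    (hv : P v) (hi : P i) (hs : P s) (ht : P t) (vA : ∀ j, G.Adj v (A j))
    (vC : ∀ j, G.Adj v (C j)) (iA : ∀ j, G.Adj i (A j)) (iC : ∀ j, G.Adj i (C j))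
    (sA : ∀ j, G.Adj s (A j)) (sC : ∀ j, G.Adj s (C j)) (tA : ∀ j, G.Adj t (A j))
    (tC : ∀ j, G.Adj t (C j)) (vi : G.Adj v i) (vs : G.Adj v s) (vt : G.Adj v t)
    (is : G.Adj i s) (ast : G.Adj s t) (ba : ∀ j, ¬ r v (A j)) (rc : ∀ j, r v (C j))
    (bi : ¬ r v i) (rs : r v s) (rt : r v t) : False := by
  have hA' := cyc_red hc hA vA ba
  have hR' := red_side hc hR hv
  have pC : ∀ j, P (C j) ∧ G.Adj v (C j) ∧ r v (C j) := fun j => ⟨hCP j, vC j, rc j⟩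
  have pS : P s ∧ G.Adj v s ∧ r v s := ⟨hs, vs, rs⟩
  have pT : P t ∧ G.Adj v t ∧ r v t := ⟨ht, vt, rt⟩
  have sy : ∀ x y, r x y ↔ r y x := fun x y => ⟨hc.symm x y, hc.symm y x⟩
  have ria : ∀ j, r i (A j) := by
    intro j
    have := hc.blue v i (A j) vi (vA j) (iA j)
    have := ba j
    tauto
  have F1 : ∀ x, P x → G.Adj i x → (∀ j, G.Adj x (A j)) → r i x →
      ∀ j, ¬ (r x (A j) ∧ r x (A (j + 1))) := fun x px ix xA rx j h =>
    hR.four hc hi px (hAP j) (hAP (j + 1)) ix (iA _) (iA _) (xA _) (xA _) (hA j)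
      ⟨rx, ria _, ria _, h.1, h.2, hA' j⟩
  have F2 : ∀ p x y, P p → P x → P y → G.Adj i p → (∀ j, G.Adj p (A j)) → (∀ j, G.Adj x (A j)) →
      (∀ j, G.Adj y (A j)) → G.Adj p x → G.Adj p y → G.Adj x y → r i p → r p x ∨ r p y := by
    intro p x y pp px py ip pA xA yA apx apy axy rp
    by_contra hcon
    obtain ⟨j, h1, h2⟩ := indep_gap _ (F1 p pp ip pA rp)
    have e1 := hc.blue p x y apx apy axy
    have e2 := hc.blue p x (A j) apx (pA _) (xA _)
    have e3 := hc.blue p x (A (j + 1)) apx (pA _) (xA _)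
    have e4 := hc.blue p y (A j) apy (pA _) (yA _)
    have e5 := hc.blue p y (A (j + 1)) apy (pA _) (yA _)
    have e6 := hR.four hc px py (hAP j) (hAP (j + 1)) axy (xA _) (xA _) (yA _) (yA _) (hA j)
    have e7 := hA' j
    grind
  have F2' : ∀ p q, P p → P q → G.Adj i p → G.Adj i q → (∀ j, G.Adj p (A j)) →
      (∀ j, G.Adj q (A j)) → G.Adj p q → (r i p ↔ r i q) → r p q := by
    intro p q pp pq ip iq pA qA apq h
    by_cases h1 : r i p
    · obtain ⟨j, g1, g2⟩ := indep_two _ _ (F1 p pp ip pA h1) (F1 q pq iq qA (h.1 h1))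
      have := hc.blue p q (A j) apq (pA j) (qA j)
      tauto
    · have := hc.blue i p q ip iq apq
      tauto
  have cA : ∀ k j, G.Adj (C k) (A j) := fun k j => (hAC j k).symm
  refine bool2 (fun j => r i (C j)) (fun j => r (C j) (C (j + 1))) (fun j => r s (C j))
    (fun j => r t (C j)) (r i s) (r s t) ?_ ?_ ?_ ?_ ?_ ?_ ?_ ?_ ?_ ?_ ?_ ?_ ?_ ?_ ?_
  · intro j h
    exact F2' _ _ (hCP _) (hCP _) (iC _) (iC _) (cA _) (cA _) (hC j) h
  · intro j h
    exact F2' _ _ hs (hCP _) is (iC _) sA (cA _) (sC j) h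
  · intro j h
    exact hR'.three hc pS (pC j) (pC (j + 1)) (sC _) (sC _) (hC j) h
  · intro j h
    exact hR'.three hc pT (pC j) (pC (j + 1)) (tC _) (tC _) (hC j) h
  · intro j h
    exact hR'.three hc pS pT (pC j) ast (sC _) (tC _) h
  · intro j h
    have := F2 (C j) s t (hCP j) hs ht (iC j) (cA j) sA tA (sC j).symm (tC j).symm ast h
    exact this.imp (hc.symm _ _) (hc.symm _ _)
  · intro j h
    have := F2 (C j) s (C (j + 1)) (hCP j) hs (hCP _) (iC j) (cA j) sA (cA _) (sC j).symm (hC j)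
      (sC _) h
    exact this.imp (hc.symm _ _) id
  · intro j h
    have := F2 (C j) t (C (j + 1)) (hCP j) ht (hCP _) (iC j) (cA j) tA (cA _) (tC j).symm (hC j)
      (tC _) h
    exact this.imp (hc.symm _ _) id
  · intro j h
    have := F2 (C (j + 1)) s (C j) (hCP _) hs (hCP _) (iC _) (cA _) sA (cA _) (sC _).symm
      (hC j).symm (sC _) h
    exact this.imp (hc.symm _ _) (hc.symm _ _)
  · intro j h
    have := F2 (C (j + 1)) t (C j) (hCP _) ht (hCP _) (iC _) (cA _) tA (cA _) (tC _).symm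
      (hC j).symm (tC _) h
    exact this.imp (hc.symm _ _) (hc.symm _ _)
  · intro j h
    exact F2 s t (C j) hs ht (hCP _) is sA tA (cA _) ast (sC _) (tC _) h
  · intro j h
    exact F2 s (C j) (C (j + 1)) hs (hCP _) (hCP _) is sA (cA _) (cA _) (sC _) (sC _) (hC j) h
  · intro j
    have := hc.blue s (C j) (C (j + 1)) (sC _) (sC _) (hC j)
    tauto
  · intro j
    have := hc.blue t (C j) (C (j + 1)) (tC _) (tC _) (hC j)
    tauto
  · intro j
    have := hc.blue s t (C j) ast (sC _) (tC _)
    tauto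

/-- blue to `A`, red to `C`, not two adjacent blue in `B`. -/
lemma core3 (hc : Col G r) (hR : NR G r P 4) {A B C : Fin 5 → V}
    (hA : ∀ i, G.Adj (A i) (A (i + 1)))
    (hB : ∀ i, G.Adj (B i) (B (i + 1))) (hC : ∀ i, G.Adj (C i) (C (i + 1)))
    (hAB : ∀ i j, G.Adj (A i) (B j)) (hAC : ∀ i j, G.Adj (A i) (C j))
    (hBC : ∀ i j, G.Adj (B i) (C j)) (hAP : ∀ i, P (A i)) (hBP : ∀ i, P (B i))
    (hCP : ∀ i, P (C i)) {v : V} (hv : P v) (vA : ∀ j, G.Adj v (A j)) (vB : ∀ j, G.Adj v (B j))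
    (vC : ∀ j, G.Adj v (C j)) (ba : ∀ j, ¬ r v (A j)) (rb : ∀ j, ¬ r v (B j) → r v (B (j + 1)))
    (rc : ∀ j, r v (C j)) : False := by
  by_cases hall : ∀ j, r v (B j)
  · exact core1 hc hR hA hB hC hAB hAC hBC hAP hBP hCP hv vA vB vC ba hall rc
  push Not at hall
  obtain ⟨i, hi⟩ := hall
  have bA : ∀ k j, G.Adj (B k) (A j) := fun k j => (hAB j k).symm
  have e1 : i + 4 + 1 = i := (by decide : ∀ i : Fin 5, i + 4 + 1 = i) i
  have e2 : i + 3 + 1 = i + 4 := (by decide : ∀ i : Fin 5, i + 3 + 1 = i + 4) i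
  have e3 : i + 1 + 1 + 1 = i + 3 := (by decide : ∀ i : Fin 5, i + 1 + 1 + 1 = i + 3) i
  have g1 := rb i hi
  have g4 : r v (B (i + 4)) := by
    by_contra h
    have := rb _ h
    rw [e1] at this
    exact hi this
  by_cases g2 : r v (B (i + 1 + 1))
  · exact core2 hc hR hA hC hAC hAP hCP hv (hBP i) (hBP (i + 1)) (hBP (i + 1 + 1)) vA vC (bA _)
      (hBC _) (bA _) (hBC _) (bA _) (hBC _) (vB _) (vB _) (vB _) (hB _) (hB _) ba rc hi g1 g2
  · have g3 := rb _ g2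
    rw [e3] at g3
    have a1 := hB (i + 4)
    rw [e1] at a1
    have a2 := hB (i + 3)
    rw [e2] at a2
    exact core2 hc hR hA hC hAC hAP hCP hv (hBP i) (hBP (i + 4)) (hBP (i + 3)) vA vC (bA _)
      (hBC _) (bA _) (hBC _) (bA _) (hBC _) (vB _) (vB _) (vB _) a1.symm a2.symm ba rc hi g4 g3

/-- `K₁ + C₅ + C₅ + C₅ → (3,4)`. -/
lemma K1C5C5C5 (hc : Col G r) (hR : NR G r P 4) {A B C : Fin 5 → V}
    (hA : ∀ i, G.Adj (A i) (A (i + 1)))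
    (hB : ∀ i, G.Adj (B i) (B (i + 1))) (hC : ∀ i, G.Adj (C i) (C (i + 1)))
    (hAB : ∀ i j, G.Adj (A i) (B j)) (hAC : ∀ i j, G.Adj (A i) (C j))
    (hBC : ∀ i j, G.Adj (B i) (C j)) (hAP : ∀ i, P (A i)) (hBP : ∀ i, P (B i))
    (hCP : ∀ i, P (C i)) {v : V} (hv : P v) (vA : ∀ j, G.Adj v (A j)) (vB : ∀ j, G.Adj v (B j))
    (vC : ∀ j, G.Adj v (C j)) : False := by
  obtain ⟨wA, ρA, a1, a2, a3⟩ := split_cycle (G := G) r v A hA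
  obtain ⟨wB, ρB, b1, b2, b3⟩ := split_cycle (G := G) r v B hB
  obtain ⟨wC, ρC, c1, c2, c3⟩ := split_cycle (G := G) r v C hC
  have hBA : ∀ i j, G.Adj (B i) (A j) := fun i j => (hAB j i).symm
  have hCA : ∀ i j, G.Adj (C i) (A j) := fun i j => (hAC j i).symm
  have hCB : ∀ i j, G.Adj (C i) (B j) := fun i j => (hBC j i).symm
  have mem : ∀ x ∈ Set.range A ∪ Set.range B ∪ Set.range C, P x ∧ G.Adj v x := by
    rintro x ((⟨j, rfl⟩ | ⟨j, rfl⟩) | ⟨j, rfl⟩)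
    · exact ⟨hAP j, vA j⟩
    · exact ⟨hBP j, vB j⟩
    · exact ⟨hCP j, vC j⟩
  have jABC := (jn_range hAC).union_left (jn_range hBC)
  have n1 := blue_side hc hR mem ((a1.join b1 (jn_range hAB)).join c1 jABC)
  have hR' := red_side hc hR hv
  have n2 : ρA + ρB + ρC < 6 := by
    by_contra hcon
    exact K6 hc hR' (((a2.join b2 (jn_range hAB)).join c2 jABC).mono (n := 6) (not_lt.1 hcon)
      (Y := Set.univ) (fun x hx hx' => ⟨⟨(mem x hx').1, (mem x hx').2, hx⟩, trivial⟩))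
  have n3 : ∀ X Y Z : Fin 5 → V, (∀ i, G.Adj (X i) (X (i + 1))) → (∀ i j, G.Adj (Y i) (Z j)) →
      (∀ i j, G.Adj (Y i) (X j)) → (∀ i j, G.Adj (Z i) (X j)) → (∀ i, P (X i) ∧ G.Adj v (X i)) →
      (∀ i, P (Y i) ∧ G.Adj v (Y i)) → (∀ i, P (Z i) ∧ G.Adj v (Z i)) → ∀ m n,
      HK G (fun x => r v x) (Set.range Y) m → HK G (fun x => r v x) (Set.range Z) n →
      (∀ j, r v (X j)) → m + n < 3 := by
    intro X Y Z hX hYZ hYX hZX pX pY pZ m n h1 h2 hall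
    by_contra hcon
    refine K3C5 hc hR' hX (fun i => ⟨(pX i).1, (pX i).2, hall i⟩)
      ((h1.join h2 (jn_range hYZ)).mono (n := 3) (not_lt.1 hcon) (fun x hx hx' => ⟨?_, hx'⟩))
      ((jn_range hYX).union_left (jn_range hZX))
    rcases hx' with ⟨j, rfl⟩ | ⟨j, rfl⟩
    · exact ⟨(pY j).1, (pY j).2, hx⟩
    · exact ⟨(pZ j).1, (pZ j).2, hx⟩
  have pA := fun i => And.intro (hAP i) (vA i)
  have pB := fun i => And.intro (hBP i) (vB i)
  have pC := fun i => And.intro (hCP i) (vC i)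
  have nA := n3 A B C hA hBC hBA hCA pA pB pC _ _ b2 c2
  have nB := n3 B A C hB hAC hAB hCB pB pA pC _ _ a2 c2
  have nC := n3 C A B hC hAB hAC hBC pC pA pB _ _ a2 b2
  have f1 := core3 hc hR hA hB hC hAB hAC hBC hAP hBP hCP hv vA vB vC
  have f2 := core3 hc hR hA hC hB hAC hAB hCB hAP hCP hBP hv vA vC vB
  have f3 := core3 hc hR hB hA hC hBA hBC hAC hBP hAP hCP hv vB vA vC
  have f4 := core3 hc hR hB hC hA hBC hBA hCA hBP hCP hAP hv vB vC vA
  have f5 := core3 hc hR hC hA hB hCA hCB hAB hCP hAP hBP hv vC vA vB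
  have f6 := core3 hc hR hC hB hA hCB hCA hBA hCP hBP hAP hv vC vB vA
  clear n3 pA pB pC mem jABC a1 a2 b1 b2 c1 c2 hR'
  rcases a3 with ⟨e1, e2, e3⟩ | ⟨e1, e2, e4, e3⟩ | ⟨e1, e2⟩ | ⟨e1, e2, e3⟩ <;>
  rcases b3 with ⟨g1, g2, g3⟩ | ⟨g1, g2, g4, g3⟩ | ⟨g1, g2⟩ | ⟨g1, g2, g3⟩ <;>
  rcases c3 with ⟨k1, k2, k3⟩ | ⟨k1, k2, k4, k3⟩ | ⟨k1, k2⟩ | ⟨k1, k2, k3⟩ <;>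
  first
  | omega
  | (have := nA e3; omega)
  | (have := nB g3; omega)
  | (have := nC k3; omega)
  | exact f1 e3 g3 k3
  | exact f1 e3 (fun j _ => g3 _) k3
  | exact f2 e3 k3 g3
  | exact f2 e3 (fun j _ => k3 _) g3
  | exact f3 g3 e3 k3
  | exact f3 g3 (fun j _ => e3 _) k3
  | exact f4 g3 k3 e3
  | exact f4 g3 (fun j _ => k3 _) e3
  | exact f5 k3 e3 g3
  | exact f5 k3 (fun j _ => e3 _) g3
  | exact f6 k3 g3 e3
  | exact f6 k3 (fun j _ => g3 _) e3

/-! ### The main argument -/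

lemma side5 (hc : Col G r) (hR : NR G r P 5) {D : Fin 4 → Fin 5 → V}
    (hD : ∀ i a, G.Adj (D i a) (D i (a + 1)))
    (hDD : ∀ i j, i ≠ j → ∀ a b, G.Adj (D i a) (D j b)) (hDP : ∀ i a, P (D i a))
    {v : V} {s : Finset V} (hs : s.card = 3) (hs1 : ∀ x ∈ s, ∀ y ∈ s, x ≠ y → G.Adj x y)
    (hsP : ∀ x ∈ s, P x) (hvP : P v) (hv : ∀ x ∈ s, G.Adj v x)
    (sD : ∀ x ∈ s, ∀ i a, G.Adj x (D i a)) (vD : ∀ i a, G.Adj v (D i a)) :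
    (∀ x ∈ s, r v x) ∧ ∃ p : Fin 4 → Bool, (∀ i, p i = true → ∀ a, r v (D i a)) ∧
      (∀ i, p i = false → ∀ a, ¬ r v (D i a)) ∧
      ((p 0).toNat + (p 1).toNat + (p 2).toNat + (p 3).toNat = 2) := by
  obtain ⟨n, m, h1, h2, h3, h4, -, -⟩ := split_clique (G := G) r v s hs1
  choose w ρ d1 d2 d3 using fun i => split_cycle (G := G) r v (D i) (hD i)
  have jS : ∀ i, Jn G (s : Set V) (Set.range (D i)) := by
    rintro i x hx _ ⟨a, rfl⟩
    exact sD x hx i a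
  have jD : ∀ i j, i ≠ j → Jn G (Set.range (D i)) (Set.range (D j)) :=
    fun i j h => jn_range (hDD i j h)
  have memS : ∀ x ∈ (s : Set V), P x ∧ G.Adj v x := fun x hx => ⟨hsP x hx, hv x hx⟩
  have memD : ∀ i, ∀ x ∈ Set.range (D i), P x ∧ G.Adj v x := by
    rintro i _ ⟨a, rfl⟩
    exact ⟨hDP i a, vD i a⟩
  have j1 := (jS 1).union_left (jD 0 1 (by decide))
  have j2 := ((jS 2).union_left (jD 0 2 (by decide))).union_left (jD 1 2 (by decide))
  have j3 := (((jS 3).union_left (jD 0 3 (by decide))).union_left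
    (jD 1 3 (by decide))).union_left (jD 2 3 (by decide))
  have mem : ∀ x ∈ (s : Set V) ∪ Set.range (D 0) ∪ Set.range (D 1) ∪ Set.range (D 2) ∪
      Set.range (D 3), P x ∧ G.Adj v x := by
    rintro x ((((hx | hx) | hx) | hx) | hx)
    · exact memS x hx
    all_goals exact memD _ x hx
  have n1 := blue_side hc hR mem
    ((((h2.join (d1 0) (jS 0)).join (d1 1) j1).join (d1 2) j2).join (d1 3) j3)
  have hR' := red_side hc hR hvP
  have n2 : m + ρ 0 + ρ 1 + ρ 2 + ρ 3 < 9 := by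
    by_contra hcon
    exact K9 hc hR'
      (((((h3.join (d2 0) (jS 0)).join (d2 1) j1).join (d2 2) j2).join (d2 3) j3).mono (n := 9)
        (not_lt.1 hcon) (Y := Set.univ)
        (fun x hx hx' => ⟨⟨(mem x hx').1, (mem x hx').2, hx⟩, trivial⟩))
  have n3 : ∀ i j k l, i ≠ j → i ≠ k → i ≠ l → j ≠ k → j ≠ l → k ≠ l → (∀ a, r v (D i a)) →
      (∀ a, r v (D j a)) → m + ρ k + ρ l < 4 := by
    intro i j k l ij ik il jk jl kl hi hj
    by_contra hcon
    refine K4C5C5 hc hR' (hD i) (hD j) (hDD i j ij) (fun a => ⟨hDP i a, vD i a, hi a⟩)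
      (fun a => ⟨hDP j a, vD j a, hj a⟩)
      (((h3.join (d2 k) (jS k)).join (d2 l) ((jS l).union_left (jD k l kl))).mono (n := 4)
        (not_lt.1 hcon) (fun x hx hx' => ⟨?_, hx'⟩))
      (((jS i).union_left (jD k i ik.symm)).union_left (jD l i il.symm))
      (((jS j).union_left (jD k j jk.symm)).union_left (jD l j jl.symm))
    rcases hx' with (hx' | hx') | hx'
    · exact ⟨(memS x hx').1, (memS x hx').2, hx⟩
    · exact ⟨(memD _ x hx').1, (memD _ x hx').2, hx⟩
    · exact ⟨(memD _ x hx').1, (memD _ x hx').2, hx⟩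
  have n4 : ∀ i j k l, i ≠ j → i ≠ k → i ≠ l → j ≠ k → j ≠ l → k ≠ l → (∀ a, r v (D i a)) →
      (∀ a, r v (D j a)) → (∀ a, r v (D k a)) → m + ρ l < 1 := by
    intro i j k l ij ik il jk jl kl hi hj hk
    by_contra hcon
    obtain ⟨t, ht, -, ht2⟩ := (h3.join (d2 l) (jS l)).mono (n := 1) (not_lt.1 hcon)
      (fun x hx hx' => ⟨hx, hx'⟩)
    obtain ⟨x, rfl⟩ := Finset.card_eq_one.1 ht
    obtain ⟨hx, hx'⟩ := ht2 x (by simp)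
    have px : P x ∧ G.Adj v x ∧ r v x := by
      rcases hx' with hx' | hx'
      · exact ⟨(memS x hx').1, (memS x hx').2, hx⟩
      · exact ⟨(memD _ x hx').1, (memD _ x hx').2, hx⟩
    have xD : ∀ i, i ≠ l → ∀ a, G.Adj x (D i a) := fun i hi a =>
      (jS i).union_left (jD l i hi.symm) x hx' _ ⟨a, rfl⟩
    exact K1C5C5C5 hc hR' (hD i) (hD j) (hD k) (hDD i j ij) (hDD i k ik) (hDD j k jk)
      (fun a => ⟨hDP i a, vD i a, hi a⟩) (fun a => ⟨hDP j a, vD j a, hj a⟩)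
      (fun a => ⟨hDP k a, vD k a, hk a⟩) px (xD i il) (xD j jl) (xD k kl)
  have n01 := n3 0 1 2 3 (by decide) (by decide) (by decide) (by decide) (by decide) (by decide)
  have n02 := n3 0 2 1 3 (by decide) (by decide) (by decide) (by decide) (by decide) (by decide)
  have n03 := n3 0 3 1 2 (by decide) (by decide) (by decide) (by decide) (by decide) (by decide)
  have n12 := n3 1 2 0 3 (by decide) (by decide) (by decide) (by decide) (by decide) (by decide)
  have n13 := n3 1 3 0 2 (by decide) (by decide) (by decide) (by decide) (by decide) (by decide)
  have n23 := n3 2 3 0 1 (by decide) (by decide) (by decide) (by decide) (by decide) (by decide)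
  have m3 := n4 0 1 2 3 (by decide) (by decide) (by decide) (by decide) (by decide) (by decide)
  have m2 := n4 0 1 3 2 (by decide) (by decide) (by decide) (by decide) (by decide) (by decide)
  have m1 := n4 0 2 3 1 (by decide) (by decide) (by decide) (by decide) (by decide) (by decide)
  have m0 := n4 1 2 3 0 (by decide) (by decide) (by decide) (by decide) (by decide) (by decide)
  have d30 := d3 0
  have d31 := d3 1
  have d32 := d3 2
  have d33 := d3 3
  clear n3 n4 mem memS memD j1 j2 j3 jS jD d1 d2 d3 h2 h3
  rw [hs] at h1
  have pat : ∀ q0 q1 q2 q3 : Bool, (∀ a, if q0 then r v (D 0 a) else ¬ r v (D 0 a)) →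
      (∀ a, if q1 then r v (D 1 a) else ¬ r v (D 1 a)) →
      (∀ a, if q2 then r v (D 2 a) else ¬ r v (D 2 a)) →
      (∀ a, if q3 then r v (D 3 a) else ¬ r v (D 3 a)) →
      q0.toNat + q1.toNat + q2.toNat + q3.toNat = 2 → n = 0 →
    (∀ x ∈ s, r v x) ∧ ∃ p : Fin 4 → Bool, (∀ i, p i = true → ∀ a, r v (D i a)) ∧
      (∀ i, p i = false → ∀ a, ¬ r v (D i a)) ∧
      ((p 0).toNat + (p 1).toNat + (p 2).toNat + (p 3).toNat = 2) := by
    intro q0 q1 q2 q3 g0 g1 g2 g3 hq hn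
    refine ⟨h4 hn, ![q0, q1, q2, q3], ?_, ?_, hq⟩
    · intro i
      fin_cases i
      · intro h a
        have := g0 a
        change q0 = true at h
        subst h
        simpa using this
      · intro h a
        have := g1 a
        change q1 = true at h
        subst h
        simpa using this
      · intro h a
        have := g2 a
        change q2 = true at h
        subst h
        simpa using this
      · intro h a
        have := g3 a
        change q3 = true at h
        subst h
        simpa using this
    · intro i
      fin_cases i
      · intro h a
        have := g0 a
        change q0 = false at h
        subst h
        simpa using this
      · intro h a
        have := g1 a
        change q1 = false at h
        subst h
        simpa using this
      · intro h a
        have := g2 a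
        change q2 = false at h
        subst h
        simpa using this
      · intro h a
        have := g3 a
        change q3 = false at h
        subst h
        simpa using this
  rcases d30 with ⟨a1, a2, a3⟩ | ⟨a1, a2, -, a3⟩ | ⟨a1, a2⟩ | ⟨a1, a2, a3⟩ <;>
  rcases d31 with ⟨b1, b2, b3⟩ | ⟨b1, b2, -, b3⟩ | ⟨b1, b2⟩ | ⟨b1, b2, b3⟩ <;>
  rcases d32 with ⟨e1, e2, e3⟩ | ⟨e1, e2, -, e3⟩ | ⟨e1, e2⟩ | ⟨e1, e2, e3⟩ <;>
  rcases d33 with ⟨f1, f2, f3⟩ | ⟨f1, f2, -, f3⟩ | ⟨f1, f2⟩ | ⟨f1, f2, f3⟩ <;>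
  first
  | (exfalso; omega)
  | (have := m3 a3 b3 e3; exfalso; omega)
  | (have := m2 a3 b3 f3; exfalso; omega)
  | (have := m1 a3 e3 f3; exfalso; omega)
  | (have := m0 b3 e3 f3; exfalso; omega)
  | (have := n01 a3 b3; exfalso; omega)
  | (have := n02 a3 e3; exfalso; omega)
  | (have := n03 a3 f3; exfalso; omega)
  | (have := n12 b3 e3; exfalso; omega)
  | (have := n13 b3 f3; exfalso; omega)
  | (have := n23 e3 f3; exfalso; omega)
  | exact pat true true false false a3 b3 (by simpa using e3) (by simpa using f3) rfl (by omega)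
  | exact pat true false true false a3 (by simpa using b3) e3 (by simpa using f3) rfl (by omega)
  | exact pat true false false true a3 (by simpa using b3) (by simpa using e3) f3 rfl (by omega)
  | exact pat false true true false (by simpa using a3) b3 e3 (by simpa using f3) rfl (by omega)
  | exact pat false true false true (by simpa using a3) b3 (by simpa using e3) f3 rfl (by omega)
  | exact pat false false true true (by simpa using a3) (by simpa using b3) e3 f3 rfl (by omega)

def tab (c : Fin 6) : Fin 4 → Bool :=
  ![![true, true, false, false], ![true, false, true, false], ![true, false, false, true],
    ![false, true, true, false], ![false, true, false, true], ![false, false, true, true]] c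

lemma tab_spec (p : Fin 4 → Bool)
    (h : (p 0).toNat + (p 1).toNat + (p 2).toNat + (p 3).toNat = 2) : ∃ c, p = tab c := by
  revert p
  decide

lemma tab_four (c : Fin 4 → Fin 6) :
    (∃ u v w i, u ≠ v ∧ u ≠ w ∧ v ≠ w ∧ tab (c u) i = true ∧ tab (c v) i = true ∧
      tab (c w) i = true) ∨ (∃ u v, u ≠ v ∧ ∀ i, tab (c u) i = !tab (c v) i) := by
  revert c
  decide +kernel

lemma four_other (u v w : Fin 4) (h1 : u ≠ v) (h2 : u ≠ w) (h3 : v ≠ w) :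
    ∃ x, x ≠ u ∧ x ≠ v ∧ x ≠ w := by
  revert u v w
  decide

lemma two_false (c : Fin 6) : ∃ i j, i ≠ j ∧ tab c i = false ∧ tab c j = false := by
  revert c
  decide

lemma main (hc : Col G r) (hR : NR G r P 5) {K : Fin 4 → V} {D : Fin 4 → Fin 5 → V}
    (hK : ∀ i j, i ≠ j → G.Adj (K i) (K j)) (hKD : ∀ k i a, G.Adj (K k) (D i a))
    (hD : ∀ i a, G.Adj (D i a) (D i (a + 1)))
    (hDD : ∀ i j, i ≠ j → ∀ a b, G.Adj (D i a) (D j b)) (hDP : ∀ i a, P (D i a))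
    (hKP : ∀ k, P (K k)) : False := by
  classical
  have inj : Function.Injective K := by
    intro i j h
    by_contra hij
    exact (hK i j hij).ne h
  have side : ∀ k, (∀ l, l ≠ k → r (K k) (K l)) ∧ ∃ c : Fin 6,
      (∀ i, tab c i = true → ∀ a, r (K k) (D i a)) ∧
      (∀ i, tab c i = false → ∀ a, ¬ r (K k) (D i a)) := by
    intro k
    have memk : ∀ x, x ∈ (Finset.univ.erase k).image K ↔ ∃ l, l ≠ k ∧ K l = x := by simp
    obtain ⟨h1, p, h2, h3, h4⟩ := side5 hc hR hD hDD hDP (v := K k)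
      (s := (Finset.univ.erase k).image K)
      (by rw [Finset.card_image_of_injective _ inj, Finset.card_erase_of_mem (Finset.mem_univ _)]
          simp)
      (by
        intro x hx y hy hxy
        obtain ⟨l, -, rfl⟩ := (memk x).1 hx
        obtain ⟨l', -, rfl⟩ := (memk y).1 hy
        exact hK l l' (fun h => hxy (by rw [h])))
      (by
        intro x hx
        obtain ⟨l, -, rfl⟩ := (memk x).1 hx
        exact hKP l)
      (hKP k)
      (by
        intro x hx
        obtain ⟨l, hl, rfl⟩ := (memk x).1 hx
        exact hK k l hl.symm)
      (by
        intro x hx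
        obtain ⟨l, -, rfl⟩ := (memk x).1 hx
        exact hKD l)
      (hKD k)
    obtain ⟨c, rfl⟩ := tab_spec p h4
    exact ⟨fun l hl => h1 _ ((memk _).2 ⟨l, hl, rfl⟩), c, h2, h3⟩
  choose hred c hr hb using side
  have rK : ∀ k l, k ≠ l → r (K k) (K l) := fun k l h => hred k l h.symm
  rcases tab_four c with ⟨u, v, w, i, uv, uw, vw, hu, hv, hw⟩ | ⟨u, v, uv, h⟩
  · obtain ⟨x, xu, xv, xw⟩ := four_other u v w uv uw vw
    have ru := hr u i hu
    have rv := hr v i hv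
    have rw' := hr w i hw
    cases hx : tab (c x) i
    · have e := cyc_red hc (hD i) (hKD x i) (hb x i hx) 0
      exact hR.five hc (hKP u) (hKP v) (hKP w) (hDP i 0) (hDP i (0 + 1)) (hK _ _ uv) (hK _ _ uw)
        (hKD _ _ _) (hKD _ _ _) (hK _ _ vw) (hKD _ _ _) (hKD _ _ _) (hKD _ _ _) (hKD _ _ _)
        (hD i 0) (rK _ _ uv) (rK _ _ uw) (ru _) (ru _)
        ⟨rK _ _ vw, rv _, rv _, rw' _, rw' _, e⟩
    · have rx := hr x i hx
      exact hR.five hc (hKP u) (hKP v) (hKP w) (hKP x) (hDP i 0) (hK _ _ uv) (hK _ _ uw)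
        (hK _ _ xu.symm) (hKD _ _ _) (hK _ _ vw) (hK _ _ xv.symm) (hKD _ _ _) (hK _ _ xw.symm)
        (hKD _ _ _) (hKD _ _ _) (rK _ _ uv) (rK _ _ uw) (rK _ _ xu.symm) (ru _)
        ⟨rK _ _ vw, rK _ _ xv.symm, rv _, rK _ _ xw.symm, rw' _, rx _⟩
  · obtain ⟨i, j, ij, hi, hj⟩ := two_false (c u)
    have vi : tab (c v) i = true := by
      have := h i
      rw [hi] at this
      simpa using this.symm
    have vj : tab (c v) j = true := by
      have := h j
      rw [hj] at this
      simpa using this.symm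
    have ri := hr v i vi
    have rj := hr v j vj
    have bi := hb u i hi
    have bj := hb u j hj
    have ei := cyc_red hc (hD i) (hKD u i) bi 0
    have ej := cyc_red hc (hD j) (hKD u j) bj 0
    have cross : ∀ a b, r (D i a) (D j b) := by
      intro a b
      have := hc.blue (K u) (D i a) (D j b) (hKD _ _ _) (hKD _ _ _) (hDD i j ij a b)
      have := bi a
      have := bj b
      tauto
    exact hR.five hc (hKP v) (hDP i 0) (hDP i (0 + 1)) (hDP j 0) (hDP j (0 + 1)) (hKD _ _ _)
      (hKD _ _ _) (hKD _ _ _) (hKD _ _ _) (hD i 0) (hDD i j ij _ _) (hDD i j ij _ _)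
      (hDD i j ij _ _) (hDD i j ij _ _) (hD j 0) (ri _) (ri _) (rj _) (rj _)
      ⟨ei, cross _ _, cross _ _, cross _ _, cross _ _, ej⟩

lemma arrows_of {K : Fin 4 → V} {D : Fin 4 → Fin 5 → V}
    (hK : ∀ i j, i ≠ j → G.Adj (K i) (K j)) (hKD : ∀ k i a, G.Adj (K k) (D i a))
    (hD : ∀ i a, G.Adj (D i a) (D i (a + 1)))
    (hDD : ∀ i j, i ≠ j → ∀ a b, G.Adj (D i a) (D j b)) : Arrows G 3 5 := by
  classical
  rintro E1 E2 ⟨hE, -⟩ ⟨h3, h5⟩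
  have col : Col G (fun x y => s(x, y) ∈ E2) := by
    constructor
    · intro x y h
      rwa [Sym2.eq_swap]
    · intro x y z xy xz yz
      by_contra hcon
      push Not at hcon
      obtain ⟨n1, n2, n3⟩ := hcon
      have toE : ∀ a b, G.Adj a b → s(a, b) ∉ E2 → s(a, b) ∈ E1 := by
        intro a b hab hn
        have : s(a, b) ∈ E1 ∪ E2 := by rw [hE]; exact hab
        exact this.resolve_right hn
      have m1 := toE _ _ xy n1
      have m2 := toE _ _ xz n2
      have m3 := toE _ _ yz n3
      refine h3 ⟨{x, y, z}, SimpleGraph.is3Clique_triple_iff.2 ⟨xy, xz, yz⟩, ?_⟩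
      simp only [Finset.mem_insert, Finset.mem_singleton]
      rintro a (rfl | rfl | rfl) b (rfl | rfl | rfl) hab <;>
        first
        | exact absurd rfl hab
        | assumption
        | (rw [Sym2.eq_swap]; assumption)
  refine main (P := fun _ => True) col ?_ hK hKD hD hDD (fun _ _ => trivial) (fun _ => trivial)
  intro s hs h _
  refine h5 ⟨s, ⟨?_, hs⟩, fun x hx y hy hxy => (h x hx y hy hxy).2⟩
  intro x hx y hy hxy
  exact (h x hx y hy hxy).1

/-! ### The graph `G24` -/

lemma join_bound {α β : Type*} {G : SimpleGraph α} {H : SimpleGraph β} {m n : ℕ}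
    (hG : G.CliqueFree (m + 1)) (hH : H.CliqueFree (n + 1)) :
    (graphJoin G H).CliqueFree (m + n + 1) := by
  rintro s ⟨hs, hcard⟩
  have h1 : s.toLeft.card ≤ m := by
    by_contra hcon
    refine hG.mono (not_le.1 hcon) s.toLeft ⟨?_, rfl⟩
    intro x hx y hy hxy
    exact hs (Finset.mem_toLeft.1 hx) (Finset.mem_toLeft.1 hy) (fun h => hxy (Sum.inl_injective h))
  have h2 : s.toRight.card ≤ n := by
    by_contra hcon
    refine hH.mono (not_le.1 hcon) s.toRight ⟨?_, rfl⟩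
    intro x hx y hy hxy
    exact hs (Finset.mem_toRight.1 hx) (Finset.mem_toRight.1 hy)
      (fun h => hxy (Sum.inr_injective h))
  have := s.card_toLeft_add_card_toRight
  omega

lemma c5_free : (cycleGraph 5).CliqueFree (2 + 1) := by
  intro s hs
  obtain ⟨a, b, c, h1, h2, h3, -⟩ := SimpleGraph.is3Clique_iff.1 hs
  revert a b c
  decide

lemma G24_free : G24.CliqueFree 13 :=
  join_bound (m := 4) (n := 8) (SimpleGraph.cliqueFree_of_card_lt (by simp))
    (join_bound (m := 2) (n := 6) c5_free
      (join_bound (m := 2) (n := 4) c5_free (join_bound (m := 2) (n := 2) c5_free c5_free)))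

def K24 (k : Fin 4) : V24 := .inl k

def D24 (i : Fin 4) (a : Fin 5) : V24 :=
  match i with
  | 0 => .inr (.inl a)
  | 1 => .inr (.inr (.inl a))
  | 2 => .inr (.inr (.inr (.inl a)))
  | 3 => .inr (.inr (.inr (.inr a)))

lemma hK24 (i j : Fin 4) (h : i ≠ j) : G24.Adj (K24 i) (K24 j) := h

lemma hKD24 (k i : Fin 4) (a : Fin 5) : G24.Adj (K24 k) (D24 i a) := by
  fin_cases i <;> trivial

lemma c5_adj (a : Fin 5) : (cycleGraph 5).Adj a (a + 1) := by
  revert a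
  decide

lemma hD24 (i : Fin 4) (a : Fin 5) : G24.Adj (D24 i a) (D24 i (a + 1)) := by
  fin_cases i <;> exact c5_adj a

lemma hDD24 (i j : Fin 4) (h : i ≠ j) (a b : Fin 5) : G24.Adj (D24 i a) (D24 j b) := by
  fin_cases i <;> fin_cases j <;> first | exact absurd rfl h | trivial

lemma lt_of_free {W : Type*} [Finite W] {H : SimpleGraph W} {n : ℕ} (h : H.CliqueFree n) :
    H.cliqueNum < n := by
  by_contra hcon
  obtain ⟨s, hs⟩ := H.exists_isNClique_cliqueNum
  exact h.mono (not_lt.1 hcon) s hs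

lemma G24_clique : ∃ s : Finset V24, G24.IsClique s ∧ s.card = 12 := by
  have h : HK G24 (fun _ => True) Set.univ 12 := by
    have hk : HK G24 (fun _ => True) (Set.range K24) 4 := by
      refine ⟨Finset.univ.image K24, by decide, ?_, by simp⟩
      simp only [Finset.mem_image, Finset.mem_univ, true_and]
      rintro _ ⟨i, rfl⟩ _ ⟨j, rfl⟩ hij
      exact hK24 i j (fun h => hij (by rw [h]))
    have hd : ∀ i, HK G24 (fun _ => True) (Set.range (D24 i)) 2 := fun i =>
      HK.two trivial ⟨0, rfl⟩ trivial ⟨0 + 1, rfl⟩ (hD24 i 0)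
    have jK : ∀ i, Jn G24 (Set.range K24) (Set.range (D24 i)) := by
      rintro i _ ⟨k, rfl⟩ _ ⟨a, rfl⟩
      exact hKD24 k i a
    have jD : ∀ i j, i ≠ j → Jn G24 (Set.range (D24 i)) (Set.range (D24 j)) :=
      fun i j h => jn_range (hDD24 i j h)
    exact ((((hk.join (hd 0) (jK 0)).join (hd 1) ((jK 1).union_left (jD 0 1 (by decide)))).join
      (hd 2) (((jK 2).union_left (jD 0 2 (by decide))).union_left (jD 1 2 (by decide)))).join
      (hd 3) ((((jK 3).union_left (jD 0 3 (by decide))).union_left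
        (jD 1 3 (by decide))).union_left (jD 2 3 (by decide)))).mono (n := 12) (by norm_num)
      (fun x _ _ => ⟨trivial, trivial⟩)
  obtain ⟨s, hs, h1, -⟩ := h
  exact ⟨s, fun x hx y hy hxy => h1 x hx y hy hxy, hs⟩

lemma G24_cliqueNum : G24.cliqueNum = 12 := by
  have h1 := lt_of_free G24_free
  obtain ⟨s, hs, h2⟩ := G24_clique
  have h3 := hs.card_le_cliqueNum
  omega

lemma G24_fin : ∃ G : SimpleGraph (Fin 24), Arrows G 3 5 ∧ G.cliqueNum < 13 := by
  have hcard : Fintype.card V24 = 24 := by simp [V24]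
  let e : V24 ≃ Fin 24 := Fintype.equivFinOfCardEq hcard
  refine ⟨G24.comap e.symm, arrows_of (K := fun k => e (K24 k)) (D := fun i a => e (D24 i a))
    ?_ ?_ ?_ ?_, lt_of_free ?_⟩
  · intro i j h
    simpa using hK24 i j h
  · intro k i a
    simpa using hKD24 k i a
  · intro i a
    simpa using hD24 i a
  · intro i j h a b
    simpa using hDD24 i j h a b
  · exact G24_free.comap ⟨(SimpleGraph.Iso.comap e.symm G24).toCopy⟩

end Folk

/-- **Corollary 5.2.** `F(3,5;13) ≤ 24`: the graph `G = K₄ + C₅ + C₅ + C₅ + C₅`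
has `|V(G)| = 24`, clique number `cl(G) = 12 < 13`, and `G → (3,5)`. -/
theorem folkman_3_5_13_le_24 :
    Fintype.card V24 = 24 ∧ G24.cliqueNum = 12 ∧ 12 < 13 ∧ Arrows G24 3 5 ∧
    folkmanNumber 3 5 13 ≤ 24 := by
  exact ⟨by simp [V24], Folk.G24_cliqueNum, by norm_num,
    Folk.arrows_of Folk.hK24 Folk.hKD24 Folk.hD24 Folk.hDD24, Nat.sInf_le Folk.G24_fin⟩
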